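/- Let k ≥ 4 and let T be a tournament on k vertices. Then n^{-2/(k+1)} is the threshold probability for the unbiased T-tournament game on the random graph G_{n,p}: if p = p(n) satisfies p(n)·n^{2/(k+1)} → ∞ as n → ∞, then asymptotically almost surely Maker has a winning strategy in the unbiased T-tournament game on G_{n,p}, and if p(n)·n^{2/(k+1)} → 0, then asymptotically almost surely Breaker has a winning strategy. -/

import Mathlib

namespace TournamentGame

variable {V : Type*} [DecidableEq V]

/-- The underlying undirected edges of a set of oriented edges. -/
def undirect (M : Finset (V × V)) : Finset (Sym2 V) :=
  M.image fun p => s(p.1, p.2)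

/-- `MakerWin X F b M B` : in the (1:b) Maker-Breaker game on board `X`, with Maker
having claimed `M`, Breaker having claimed `B`, and Maker to move, Maker has a strategy
to claim all edges of some winning set (i.e. reach a position with `F` on her edges). -/
inductive MakerWin (X : Finset (Sym2 V)) (F : Finset (Sym2 V) → Prop) (b : ℕ) :
    Finset (Sym2 V) → Finset (Sym2 V) → Prop
  | win (M B : Finset (Sym2 V)) : F M → MakerWin X F b M B
  | move (M B : Finset (Sym2 V)) (e : Sym2 V) (heX : e ∈ X) (hefree : e ∉ M ∪ B)
      (h : ∀ B' : Finset (Sym2 V), B' ⊆ X \ (insert e M ∪ B) →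
        B'.card = min b (X \ (insert e M ∪ B)).card →
        MakerWin X F b (insert e M) (B ∪ B')) :
      MakerWin X F b M B

/-- `BreakerBlock X F b M B` : Maker to move; Breaker has a strategy ensuring that `F`
never holds on Maker's edge set. -/
inductive BreakerBlock (X : Finset (Sym2 V)) (F : Finset (Sym2 V) → Prop) (b : ℕ) :
    Finset (Sym2 V) → Finset (Sym2 V) → Prop
  | step (M B : Finset (Sym2 V)) (hF : ¬ F M) (resp : Sym2 V → Finset (Sym2 V))
      (hsub : ∀ e ∈ X, e ∉ M ∪ B → resp e ⊆ X \ (insert e M ∪ B))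
      (hcard : ∀ e ∈ X, e ∉ M ∪ B → (resp e).card = min b (X \ (insert e M ∪ B)).card)
      (h : ∀ e ∈ X, e ∉ M ∪ B → BreakerBlock X F b (insert e M) (B ∪ resp e)) :
      BreakerBlock X F b M B

/-- Oriented (tournament-game) version of `MakerWin`: Maker claims an edge together with
an orientation; her position is a set of oriented edges. -/
inductive OMakerWin (X : Finset (Sym2 V)) (F : Finset (V × V) → Prop) (b : ℕ) :
    Finset (V × V) → Finset (Sym2 V) → Prop
  | win (M : Finset (V × V)) (B : Finset (Sym2 V)) : F M → OMakerWin X F b M B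
  | move (M : Finset (V × V)) (B : Finset (Sym2 V)) (x y : V)
      (heX : s(x, y) ∈ X) (hefree : s(x, y) ∉ undirect M ∪ B)
      (h : ∀ B' : Finset (Sym2 V), B' ⊆ X \ (insert s(x, y) (undirect M) ∪ B) →
        B'.card = min b (X \ (insert s(x, y) (undirect M) ∪ B)).card →
        OMakerWin X F b (insert (x, y) M) (B ∪ B')) :
      OMakerWin X F b M B

/-- Oriented version of `BreakerBlock`. -/
inductive OBreakerBlock (X : Finset (Sym2 V)) (F : Finset (V × V) → Prop) (b : ℕ) :
    Finset (V × V) → Finset (Sym2 V) → Prop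
  | step (M : Finset (V × V)) (B : Finset (Sym2 V)) (hF : ¬ F M)
      (resp : V → V → Finset (Sym2 V))
      (hsub : ∀ x y : V, s(x, y) ∈ X → s(x, y) ∉ undirect M ∪ B →
        resp x y ⊆ X \ (insert s(x, y) (undirect M) ∪ B))
      (hcard : ∀ x y : V, s(x, y) ∈ X → s(x, y) ∉ undirect M ∪ B →
        (resp x y).card = min b (X \ (insert s(x, y) (undirect M) ∪ B)).card)
      (h : ∀ x y : V, s(x, y) ∈ X → s(x, y) ∉ undirect M ∪ B →
        OBreakerBlock X F b (insert (x, y) M) (B ∪ resp x y)) :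
      OBreakerBlock X F b M B

/-- Position with Breaker to move, in the unoriented game: Breaker can respond and
then keep blocking forever. -/
def BreakerTurn (X : Finset (Sym2 V)) (F : Finset (Sym2 V) → Prop) (b : ℕ)
    (M B : Finset (Sym2 V)) : Prop :=
  ¬ F M ∧ ∃ B' : Finset (Sym2 V), B' ⊆ X \ (M ∪ B) ∧
    B'.card = min b (X \ (M ∪ B)).card ∧ BreakerBlock X F b M (B ∪ B')

/-- Position with Breaker to move, in the oriented game. -/
def OBreakerTurn (X : Finset (Sym2 V)) (F : Finset (V × V) → Prop) (b : ℕ)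
    (M : Finset (V × V)) (B : Finset (Sym2 V)) : Prop :=
  ¬ F M ∧ ∃ B' : Finset (Sym2 V), B' ⊆ X \ (undirect M ∪ B) ∧
    B'.card = min b (X \ (undirect M ∪ B)).card ∧ OBreakerBlock X F b M (B ∪ B')

/-- Winning sets of the triangle game. -/
def HasTriangle (M : Finset (Sym2 V)) : Prop :=
  ∃ x y z : V, x ≠ y ∧ y ≠ z ∧ x ≠ z ∧ s(x, y) ∈ M ∧ s(y, z) ∈ M ∧ s(x, z) ∈ M

/-- Maker's oriented edges contain a cyclic (directed) triangle. -/
def HasCyclicTriangle (M : Finset (V × V)) : Prop :=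
  ∃ x y z : V, x ≠ y ∧ y ≠ z ∧ x ≠ z ∧ (x, y) ∈ M ∧ (y, z) ∈ M ∧ (z, x) ∈ M

/-- Maker's oriented edges contain an acyclic (transitive) triangle. -/
def HasAcyclicTriangle (M : Finset (V × V)) : Prop :=
  ∃ x y z : V, x ≠ y ∧ y ≠ z ∧ x ≠ z ∧ (x, y) ∈ M ∧ (y, z) ∈ M ∧ (x, z) ∈ M

/-- A tournament on `Fin k`, given by its arc relation. -/
def IsTournament {k : ℕ} (T : Fin k → Fin k → Prop) : Prop :=
  (∀ i, ¬ T i i) ∧ ∀ i j : Fin k, i ≠ j → (T i j ↔ ¬ T j i)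

/-- Maker's oriented edges contain a copy of the tournament `T`. -/
def HasTCopy {k : ℕ} (T : Fin k → Fin k → Prop) (M : Finset (V × V)) : Prop :=
  ∃ f : Fin k → V, Function.Injective f ∧ ∀ i j : Fin k, T i j → (f i, f j) ∈ M

/-- The edge set of the complete graph `K_n`. -/
def completeEdges (n : ℕ) : Finset (Sym2 (Fin n)) :=
  Finset.univ.filter fun e => ¬ e.IsDiag

/-- The edge set of the Turán graph `T_{n,k}` : classes are residues mod `k`. -/
def turanEdges (n k : ℕ) : Finset (Sym2 (Fin n)) :=
  Finset.univ.filter fun e => ¬ (e.map fun v : Fin n => v.val % k).IsDiag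

/-- `A` contains a good copy of `K_k` (all vertices in distinct classes of `T_{n,k}`). -/
def GoodCopy (n k : ℕ) (A : Finset (Sym2 (Fin n))) : Prop :=
  ∃ f : Fin k → Fin n, Function.Injective f ∧
    (∀ i j : Fin k, i ≠ j → (f i).val % k ≠ (f j).val % k) ∧
    (∀ i j : Fin k, i ≠ j → s(f i, f j) ∈ A)

open Classical in
/-- Probability that a `p`-random subset `A` of `E` (each element kept independently with
probability `p`) satisfies `P`. This is the model `G(E, p)`. -/
noncomputable def edgeProb {α : Type*} [DecidableEq α] (E : Finset α) (p : ℝ)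
    (P : Finset α → Prop) : ℝ :=
  ∑ A ∈ E.powerset, if P A then p ^ A.card * (1 - p) ^ (E.card - A.card) else 0

open Classical in
/-- Probability that a uniformly random `M`-element subset of `E` satisfies `P`.
This is the model `G(E, M)`. -/
noncomputable def uniformProb {α : Type*} [DecidableEq α] (E : Finset α) (M : ℕ)
    (P : Finset α → Prop) : ℝ :=
  ((E.powerset.filter fun A => A.card = M ∧ P A).card : ℝ) /
    ((E.powerset.filter fun A => A.card = M).card : ℝ)

/-- The three edges of a triangle on `x`, `y`, `z`. -/
def triEdges (x y z : V) : Finset (Sym2 V) := {s(x, y), s(y, z), s(x, z)}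

/-- `x`, `y`, `z` form a triangle of the graph with edge set `A`. -/
def IsTriangleIn (A : Finset (Sym2 V)) (x y z : V) : Prop :=
  x ≠ y ∧ y ≠ z ∧ x ≠ z ∧ s(x, y) ∈ A ∧ s(y, z) ∈ A ∧ s(x, z) ∈ A

/-- The triangles of `A`, each recorded as its set of three edges: the vertex set of `T_A`. -/
def TriSets (A : Finset (Sym2 V)) : Set (Finset (Sym2 V)) :=
  {t | ∃ x y z : V, IsTriangleIn A x y z ∧ t = triEdges x y z}

/-- `C` is a triangle collection: every edge lies in a triangle and the graph `T_C` of
triangles (adjacent iff sharing an edge) is connected. -/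
def IsTriangleCollection (C : Finset (Sym2 V)) : Prop :=
  (∀ e ∈ C, ∃ x y z : V, IsTriangleIn C x y z ∧ e ∈ triEdges x y z) ∧
  ∀ t ∈ TriSets C, ∀ t' ∈ TriSets C,
    Relation.ReflTransGen
      (fun a b => a ∈ TriSets C ∧ b ∈ TriSets C ∧ (a ∩ b).Nonempty) t t'

/-- Adjacency of `K₃⁺`: a triangle on `{0,1,2}` with a pendant edge `{2,3}`. -/
def K3plusAdj (a b : Fin 4) : Prop :=
  (a.val < 3 ∧ b.val < 3 ∧ a ≠ b) ∨ (a.val = 2 ∧ b.val = 3) ∨ (a.val = 3 ∧ b.val = 2)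

/-- Adjacency of the path on `Fin m`. -/
def pathAdj {m : ℕ} (a b : Fin m) : Prop := a.val + 1 = b.val ∨ b.val + 1 = a.val

/-- `C` is very basic: `T_C` is (isomorphic to) a subgraph of `K₃⁺` or of a path `P_m`. -/
def VeryBasic (C : Finset (Sym2 V)) : Prop :=
  (∃ φ : TriSets C → Fin 4, Function.Injective φ ∧
    ∀ t t' : TriSets C, t ≠ t' → ((t : Finset (Sym2 V)) ∩ (t' : Finset (Sym2 V))).Nonempty →
      K3plusAdj (φ t) (φ t')) ∨
  (∃ m : ℕ, ∃ φ : TriSets C → Fin m, Function.Injective φ ∧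
    ∀ t t' : TriSets C, t ≠ t' → ((t : Finset (Sym2 V)) ∩ (t' : Finset (Sym2 V))).Nonempty →
      pathAdj (φ t) (φ t'))

/-- `C` is basic: there are distinct edges `e₁, e₂` with `C - eᵢ` very basic for both. -/
def Basic (C : Finset (Sym2 V)) : Prop :=
  ∃ e₁ ∈ C, ∃ e₂ ∈ C, e₁ ≠ e₂ ∧ VeryBasic (C.erase e₁) ∧ VeryBasic (C.erase e₂)

open Classical in
/-- The set of non-isolated vertices of the graph with edge set `C`. -/
noncomputable def support [Fintype V] (C : Finset (Sym2 V)) : Finset V :=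
  Finset.univ.filter fun v => ∃ e ∈ C, v ∈ e

open Classical in
/-- Degree of `v` in the graph with edge set `C`. -/
noncomputable def degreeIn (C : Finset (Sym2 V)) (v : V) : ℕ :=
  (C.filter fun e => v ∈ e).card

/-- The maximum density `m(C) = max_{H ⊆ C} e(H)/v(H)` is (strictly) less than `r`. -/
def MaxDensityLt [Fintype V] (C : Finset (Sym2 V)) (r : ℝ) : Prop :=
  ∀ D ⊆ C, D.Nonempty → (D.card : ℝ) / ((support D).card : ℝ) < r

/-- The edge set of the `k`-wheel: a cycle on `{0, …, k-1} ⊆ Fin (k+1)` together with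
all edges to the center, the vertex `k`. -/
def wheelEdges (k : ℕ) : Finset (Sym2 (Fin (k + 1))) :=
  ((Finset.univ : Finset (Fin k)).image fun i =>
    s((⟨i.val, by have := i.2; omega⟩ : Fin (k + 1)),
      (⟨(i.val + 1) % k, by have := i.2; exact Nat.lt_succ_of_lt (Nat.mod_lt _ (by omega))⟩ :
        Fin (k + 1)))) ∪
  ((Finset.univ : Finset (Fin k)).image fun i =>
    s((⟨i.val, by have := i.2; omega⟩ : Fin (k + 1)), (Fin.last k)))

section Expectation

variable {α : Type*}

/-- Expectation of `f A` for a `p`-random subset `A` of `E`. -/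
noncomputable def edgeExp (E : Finset α) (p : ℝ) (f : Finset α → ℝ) : ℝ :=
  ∑ A ∈ E.powerset, p ^ A.card * (1 - p) ^ (E.card - A.card) * f A

open Classical in
lemma edgeProb_eq_edgeExp [DecidableEq α] (E : Finset α) (p : ℝ) (P : Finset α → Prop) :
    edgeProb E p P = edgeExp E p (fun A => if P A then 1 else 0) := by
  unfold edgeProb edgeExp
  refine Finset.sum_congr rfl fun A _ => ?_
  by_cases h : P A <;> simp [h]

lemma edgeExp_insert [DecidableEq α] {E : Finset α} {e : α} (he : e ∉ E) (p : ℝ)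
    (f : Finset α → ℝ) :
    edgeExp (insert e E) p f
      = p * edgeExp E p (fun A => f (insert e A)) + (1 - p) * edgeExp E p f := by
  unfold edgeExp
  rw [Finset.sum_powerset_insert he, add_comm, Finset.mul_sum, Finset.mul_sum]
  congr 1
  · refine Finset.sum_congr rfl fun A hA => ?_
    have hA' := Finset.mem_powerset.1 hA
    have : e ∉ A := fun h => he (hA' h)
    rw [Finset.card_insert_of_notMem this, Finset.card_insert_of_notMem he, pow_succ,
      Nat.add_sub_add_right]
    ring
  · refine Finset.sum_congr rfl fun A hA => ?_
    have hA' := Finset.card_le_card (Finset.mem_powerset.1 hA)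
    rw [Finset.card_insert_of_notMem he, Nat.sub_add_comm hA', pow_succ]
    ring

lemma edgeExp_mono {E : Finset α} {p : ℝ} (h0 : 0 ≤ p) (h1 : p ≤ 1) {f g : Finset α → ℝ}
    (h : ∀ A ⊆ E, f A ≤ g A) : edgeExp E p f ≤ edgeExp E p g := by
  have h1' : 0 ≤ 1 - p := by linarith
  exact Finset.sum_le_sum fun A hA =>
    mul_le_mul_of_nonneg_left (h A (Finset.mem_powerset.1 hA)) (by positivity)

lemma edgeExp_sum {ι : Type*} (s : Finset ι) (E : Finset α) (p : ℝ) (f : ι → Finset α → ℝ) :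
    edgeExp E p (fun A => ∑ i ∈ s, f i A) = ∑ i ∈ s, edgeExp E p (f i) := by
  unfold edgeExp
  rw [Finset.sum_comm]
  exact Finset.sum_congr rfl fun A _ => Finset.mul_sum _ _ _

lemma edgeExp_add (E : Finset α) (p : ℝ) (f g : Finset α → ℝ) :
    edgeExp E p (fun A => f A + g A) = edgeExp E p f + edgeExp E p g := by
  simp only [edgeExp, mul_add, Finset.sum_add_distrib]

lemma edgeExp_const_mul (E : Finset α) (p c : ℝ) (f : Finset α → ℝ) :
    edgeExp E p (fun A => c * f A) = c * edgeExp E p f := by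
  simp only [edgeExp, Finset.mul_sum]
  exact Finset.sum_congr rfl fun A _ => by ring

lemma edgeExp_one [DecidableEq α] (E : Finset α) (p : ℝ) : edgeExp E p (fun _ => 1) = 1 := by
  induction E using Finset.induction_on with
  | empty => simp [edgeExp]
  | insert e E he ih => rw [edgeExp_insert he, ih]; ring

lemma edgeExp_superset [DecidableEq α] {E F : Finset α} (hF : F ⊆ E) (p : ℝ) :
    edgeExp E p (fun A => if F ⊆ A then 1 else 0) = p ^ F.card := by
  induction E using Finset.induction_on generalizing F with
  | empty => simp [edgeExp, Finset.subset_empty.1 hF]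
  | insert e E he ih =>
    rw [edgeExp_insert he]
    by_cases heF : e ∈ F
    · have h1 : ∀ A, F ⊆ insert e A ↔ F.erase e ⊆ A := fun A => Finset.subset_insert_iff
      have h2 : edgeExp E p (fun A => if F ⊆ A then (1 : ℝ) else 0) = 0 := by
        refine Finset.sum_eq_zero fun A hA => ?_
        have h : ¬ F ⊆ A := fun h => he (Finset.mem_powerset.1 hA (h heF))
        simp [h]
      simp only [h1]
      rw [h2, ih (Finset.subset_insert_iff.1 hF), ← Finset.card_erase_add_one heF, pow_succ]
      ring
    · have h1 : ∀ A, F ⊆ insert e A ↔ F ⊆ A := fun A => by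
        rw [Finset.subset_insert_iff, Finset.erase_eq_of_notMem heF]
      simp only [h1]
      rw [ih (by rwa [Finset.subset_insert_iff, Finset.erase_eq_of_notMem heF] at hF)]
      ring

lemma edgeExp_card [DecidableEq α] (E : Finset α) (p : ℝ) :
    edgeExp E p (fun A => (A.card : ℝ)) = E.card * p := by
  have h : edgeExp E p (fun A => (A.card : ℝ))
      = edgeExp E p (fun A => ∑ e ∈ E, if {e} ⊆ A then (1 : ℝ) else 0) := by
    refine Finset.sum_congr rfl fun A hA => ?_
    beta_reduce
    rw [Finset.sum_boole]
    congr 3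
    ext e
    simp only [Finset.singleton_subset_iff, Finset.mem_filter]
    exact ⟨fun he => ⟨Finset.mem_powerset.1 hA he, he⟩, fun he => he.2⟩
  rw [h, edgeExp_sum, Finset.sum_congr rfl fun e he =>
    edgeExp_superset (Finset.singleton_subset_iff.2 he) p]
  simp

lemma edgeProb_le_one [DecidableEq α] {E : Finset α} {p : ℝ} (h0 : 0 ≤ p) (h1 : p ≤ 1)
    (P : Finset α → Prop) :
    edgeProb E p P ≤ 1 := by
  classical
  rw [edgeProb_eq_edgeExp]
  refine (edgeExp_mono h0 h1 fun A _ => ?_).trans_eq (edgeExp_one E p)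
  split_ifs <;> norm_num

lemma edgeProb_mono [DecidableEq α] {E : Finset α} {p : ℝ} (h0 : 0 ≤ p) (h1 : p ≤ 1)
    {P Q : Finset α → Prop}
    (h : ∀ A ⊆ E, P A → Q A) : edgeProb E p P ≤ edgeProb E p Q := by
  classical
  rw [edgeProb_eq_edgeExp, edgeProb_eq_edgeExp]
  refine edgeExp_mono h0 h1 fun A hA => ?_
  by_cases hP : P A
  · simp [hP, h A hA hP]
  · simp only [hP, if_false]
    split_ifs <;> norm_num

/-- If `f` dominates the indicator of the failure of `P`, its mean bounds the failure
probability. -/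
lemma one_sub_edgeExp_le_edgeProb [DecidableEq α] {E : Finset α} {p : ℝ} (h0 : 0 ≤ p) (h1 : p ≤ 1)
    {P : Finset α → Prop} {f : Finset α → ℝ} (hf : ∀ A ⊆ E, 0 ≤ f A)
    (h : ∀ A ⊆ E, ¬ P A → 1 ≤ f A) : 1 - edgeExp E p f ≤ edgeProb E p P := by
  classical
  have h2 : edgeExp E p (fun _ => 1) ≤
      edgeExp E p (fun A => (if P A then 1 else 0) + f A) := by
    refine edgeExp_mono h0 h1 fun A hA => ?_
    by_cases hP : P A
    · simp [hP, hf A hA]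
    · simpa [hP] using h A hA hP
  rw [edgeExp_one, edgeExp_add, ← edgeProb_eq_edgeExp] at h2
  linarith

/-- Monotone events become more likely as `p` grows. -/
lemma edgeProb_mono_right [DecidableEq α] {E : Finset α} {p q : ℝ} (h0 : 0 ≤ p) (hpq : p ≤ q)
    (h1 : q ≤ 1) {P : Finset α → Prop} (hP : ∀ A B, A ⊆ B → P A → P B) :
    edgeProb E p P ≤ edgeProb E q P := by
  classical
  induction E using Finset.induction_on generalizing P with
  | empty => simp [edgeProb]
  | insert e E he ih =>
    have h2 := ih (P := fun A => P (insert e A))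
      fun A B hAB => hP _ _ (Finset.insert_subset_insert e hAB)
    have h3 := ih hP
    have h4 : edgeProb E q P ≤ edgeProb E q (fun A => P (insert e A)) :=
      edgeProb_mono (h0.trans hpq) h1 fun A _ => hP _ _ (Finset.subset_insert e A)
    rw [edgeProb_eq_edgeExp, edgeProb_eq_edgeExp, edgeExp_insert he, edgeExp_insert he]
    simp only [edgeProb_eq_edgeExp] at h2 h3 h4
    nlinarith [mul_le_mul_of_nonneg_left h2 h0,
      mul_le_mul_of_nonneg_left h3 (by linarith : (0 : ℝ) ≤ 1 - p),
      mul_le_mul_of_nonneg_left h4 (by linarith : (0 : ℝ) ≤ q - p)]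

end Expectation

lemma undirect_insert (x y : V) (M : Finset (V × V)) :
    undirect (insert (x, y) M) = insert s(x, y) (undirect M) := by
  simp [undirect, Finset.image_insert]

section MakerCriterion

variable {ι : Type*}

/-- Weight of the winning set `F` in a position: `2 ^ (-r)` if Maker still has to claim `r` of
its edges, and `0` once Breaker has claimed one of them. -/
noncomputable def setWeight (M B F : Finset (Sym2 V)) : ℝ :=
  if Disjoint F B then (1 / 2) ^ (F \ M).card else 0

lemma setWeight_nonneg (M B F : Finset (Sym2 V)) : 0 ≤ setWeight M B F := by
  unfold setWeight; split_ifs <;> positivity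

lemma setWeight_le_one (M B F : Finset (Sym2 V)) : setWeight M B F ≤ 1 := by
  unfold setWeight
  split_ifs
  · exact pow_le_one₀ (by norm_num) (by norm_num)
  · norm_num

lemma setWeight_insert (M B F : Finset (Sym2 V)) {e : Sym2 V} (he : e ∉ M) :
    setWeight (insert e M) B F
      = setWeight M B F + if e ∈ F then setWeight M B F else 0 := by
  unfold setWeight
  by_cases hd : Disjoint F B
  · by_cases heF : e ∈ F
    · have h : (F \ M).card = (F \ insert e M).card + 1 := by
        rw [Finset.sdiff_insert, Finset.card_erase_add_one]
        exact Finset.mem_sdiff.2 ⟨heF, he⟩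
      simp only [hd, heF, if_true, h, pow_succ]
      ring
    · have h : F \ insert e M = F \ M := by
        rw [Finset.sdiff_insert, Finset.erase_eq_of_notMem]
        exact fun h => heF (Finset.mem_sdiff.1 h).1
      simp [heF, h]
  · simp [hd]

lemma setWeight_insert_right (M B F : Finset (Sym2 V)) (y : Sym2 V) :
    setWeight M (insert y B) F
      = setWeight M B F - if y ∈ F then setWeight M B F else 0 := by
  unfold setWeight
  by_cases hy : y ∈ F <;> simp [Finset.disjoint_insert_right, hy]

/-- A round of the game, in which Maker claims an edge `e` of maximum weight, decreases the
total weight of a linear family of winning sets by at most one. -/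
lemma sum_setWeight_round {S : Finset ι} {F : ι → Finset (Sym2 V)} {M B : Finset (Sym2 V)}
    (hlin : ∀ i ∈ S, ∀ j ∈ S, i ≠ j → (F i ∩ F j).card ≤ 1) {e : Sym2 V} (he : e ∉ M)
    {B' : Finset (Sym2 V)} (hcard : B'.card ≤ 1)
    (hmax : ∀ y ∈ B', y ≠ e ∧ ∑ i ∈ S, (if y ∈ F i then setWeight M B (F i) else 0)
      ≤ ∑ i ∈ S, if e ∈ F i then setWeight M B (F i) else 0) :
    ∑ i ∈ S, setWeight M B (F i) - 1 ≤ ∑ i ∈ S, setWeight (insert e M) (B ∪ B') (F i) := by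
  have hnn : 0 ≤ ∑ i ∈ S, if e ∈ F i then setWeight M B (F i) else 0 :=
    Finset.sum_nonneg fun i _ => by
      split_ifs
      · exact setWeight_nonneg _ _ _
      · rfl
  rcases B'.eq_empty_or_nonempty with rfl | ⟨y, hy⟩
  · simp only [Finset.union_empty, setWeight_insert _ _ _ he, Finset.sum_add_distrib]
    linarith
  · have hB' : B' = {y} := Finset.eq_singleton_iff_unique_mem.2
      ⟨hy, fun z hz => Finset.card_le_one.1 hcard z hz y hy⟩
    subst hB'
    obtain ⟨hye, hle⟩ := hmax y hy
    have hboth : ∑ i ∈ S, (if e ∈ F i ∧ y ∈ F i then setWeight M B (F i) else 0) ≤ 1 := by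
      rw [← Finset.sum_filter]
      have hc : (S.filter fun i => e ∈ F i ∧ y ∈ F i).card ≤ 1 := by
        rw [Finset.card_le_one]
        intro i hi j hj
        rw [Finset.mem_filter] at hi hj
        by_contra hij
        have h2 := hlin i hi.1 j hj.1 hij
        rw [Finset.card_le_one] at h2
        exact hye (h2 y (Finset.mem_inter.2 ⟨hi.2.2, hj.2.2⟩) e
          (Finset.mem_inter.2 ⟨hi.2.1, hj.2.1⟩))
      calc _ ≤ ∑ i ∈ S.filter (fun i => e ∈ F i ∧ y ∈ F i), (1 : ℝ) :=
            Finset.sum_le_sum fun i _ => setWeight_le_one _ _ _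
        _ ≤ 1 := by simpa using hc
    have hun : B ∪ {y} = insert y B := by rw [Finset.union_comm]; rfl
    have hterm : ∀ i ∈ S, setWeight (insert e M) (B ∪ {y}) (F i)
        = setWeight M B (F i) + (if e ∈ F i then setWeight M B (F i) else 0)
          - (if y ∈ F i then setWeight M B (F i) else 0)
          - (if e ∈ F i ∧ y ∈ F i then setWeight M B (F i) else 0) := by
      intro i _
      rw [hun, setWeight_insert_right, setWeight_insert _ _ _ he]
      by_cases h1 : e ∈ F i <;> by_cases h2 : y ∈ F i <;> simp [h1, h2]
    rw [Finset.sum_congr rfl hterm]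
    simp only [Finset.sum_add_distrib, Finset.sum_sub_distrib]
    linarith

/-- Maker wins as soon as the total weight of a linear family of winning sets inside `A` exceeds
the number of free edges of `A`. -/
theorem oMakerWin_of_weight {X A : Finset (Sym2 V)} (hAX : A ⊆ X) {o : Sym2 V → V × V}
    (ho : ∀ e, s((o e).1, (o e).2) = e) {S : Finset ι} {F : ι → Finset (Sym2 V)}
    (hF : ∀ i ∈ S, F i ⊆ A)
    (hlin : ∀ i ∈ S, ∀ j ∈ S, i ≠ j → (F i ∩ F j).card ≤ 1)
    {W : Finset (V × V) → Prop} (hW : ∀ M, ∀ i ∈ S, (∀ e ∈ F i, o e ∈ M) → W M)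
    (M : Finset (V × V)) (B : Finset (Sym2 V))
    (hM : ∀ e ∈ A, e ∈ undirect M → o e ∈ M)
    (hT : ((A \ (undirect M ∪ B)).card : ℝ) < ∑ i ∈ S, setWeight (undirect M) B (F i)) :
    OMakerWin X W 1 M B := by
  induction hn : (A \ (undirect M ∪ B)).card using Nat.strong_induction_on generalizing M B with
  | _ n ih =>
  rcases (A \ (undirect M ∪ B)).eq_empty_or_nonempty with hemp | hne
  · rw [hemp, Finset.card_empty, Nat.cast_zero] at hT
    obtain ⟨i, hi, hpos⟩ := Finset.exists_lt_of_sum_lt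
      (s := S) (f := fun _ => (0 : ℝ)) (by simpa using hT)
    have hd : Disjoint (F i) B := by
      by_contra hd
      simp [setWeight, hd] at hpos
    refine OMakerWin.win _ _ (hW M i hi fun e he => hM e (hF i hi he) ?_)
    have h1 := Finset.sdiff_eq_empty_iff_subset.1 hemp (hF i hi he)
    exact (Finset.mem_union.1 h1).resolve_right (Finset.disjoint_left.1 hd he)
  · obtain ⟨e, he, hmax⟩ := Finset.exists_max_image (A \ (undirect M ∪ B))
      (fun y => ∑ i ∈ S, if y ∈ F i then setWeight (undirect M) B (F i) else 0) hne
    rw [Finset.mem_sdiff] at he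
    have heM : e ∉ undirect M := fun h => he.2 (Finset.mem_union_left _ h)
    refine OMakerWin.move M B (o e).1 (o e).2 (by rw [ho]; exact hAX he.1)
      (by rw [ho]; exact he.2) fun B' hB' hcard => ?_
    rw [ho] at hB' hcard
    have hund : undirect (insert ((o e).1, (o e).2) M) = insert e (undirect M) := by
      rw [undirect_insert, ho]
    have hround := sum_setWeight_round (B := B) (B' := B') hlin heM
      (hcard.trans_le (min_le_left _ _)) fun y hy => by
        have hy' := Finset.mem_sdiff.1 (hB' hy)
        have hyn : y ∉ undirect M ∪ B := fun h =>
          hy'.2 (Finset.union_subset_union_left (Finset.subset_insert _ _) h)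
        refine ⟨fun h => hy'.2 (Finset.mem_union_left _ (h ▸ Finset.mem_insert_self _ _)), ?_⟩
        by_cases hyA : y ∈ A
        · exact hmax y (Finset.mem_sdiff.2 ⟨hyA, hyn⟩)
        · rw [Finset.sum_eq_zero fun i hi => if_neg fun h => hyA (hF i hi h)]
          exact Finset.sum_nonneg fun i _ => by
            split_ifs
            · exact setWeight_nonneg _ _ _
            · rfl
    have hlt : (A \ (insert e (undirect M) ∪ (B ∪ B'))).card < (A \ (undirect M ∪ B)).card := by
      refine Finset.card_lt_card ⟨fun z hz => ?_, fun h => ?_⟩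
      · simp only [Finset.mem_sdiff, Finset.mem_union, Finset.mem_insert] at hz ⊢
        tauto
      · have := h (Finset.mem_sdiff.2 he)
        simp at this
    refine ih _ (hn ▸ hlt) _ _ ?_ ?_ (by rw [hund])
    · intro z hzA hz
      rw [hund, Finset.mem_insert] at hz
      rcases hz with rfl | hz
      · exact Finset.mem_insert_self _ _
      · exact Finset.mem_insert_of_mem (hM z hzA hz)
    · rw [hund]
      have : ((A \ (insert e (undirect M) ∪ (B ∪ B'))).card : ℝ) + 1
          ≤ (A \ (undirect M ∪ B)).card := by exact_mod_cast hlt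
      linarith

end MakerCriterion

/-- Breaker wins by a pairing strategy if every winning set contains a pair `e`, `σ e` of some
involution `σ` without fixed point there. -/
theorem oBreakerBlock_of_pairing {X : Finset (Sym2 V)} {W : Finset (V × V) → Prop}
    {σ : Sym2 V → Sym2 V} (hσ : ∀ e, σ (σ e) = e)
    (hW : ∀ M, undirect M ⊆ X → W M → ∃ e ∈ undirect M, σ e ∈ undirect M ∧ σ e ≠ e)
    (M : Finset (V × V)) (B : Finset (Sym2 V)) (hMX : undirect M ⊆ X)
    (hdisj : Disjoint (undirect M) B)
    (hpair : ∀ e ∈ undirect M, σ e ≠ e → σ e ∈ X → σ e ∈ B) :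
    OBreakerBlock X W 1 M B := by
  induction hn : (X \ (undirect M ∪ B)).card using Nat.strong_induction_on generalizing M B with
  | _ n ih =>
  have hex : ∀ e : Sym2 V, ∃ R : Finset (Sym2 V), R ⊆ X \ (insert e (undirect M) ∪ B) ∧
      R.card = min 1 (X \ (insert e (undirect M) ∪ B)).card ∧
      (σ e ∈ X \ (insert e (undirect M) ∪ B) → σ e ∈ R) := by
    intro e
    by_cases h : σ e ∈ X \ (insert e (undirect M) ∪ B)
    · refine ⟨{σ e}, Finset.singleton_subset_iff.2 h, ?_, fun _ => Finset.mem_singleton_self _⟩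
      have := Finset.card_pos.2 ⟨_, h⟩
      rw [Finset.card_singleton]
      omega
    · obtain ⟨R, hR, hRc⟩ := Finset.exists_subset_card_eq
        (min_le_right 1 (X \ (insert e (undirect M) ∪ B)).card)
      exact ⟨R, hR, hRc, fun h' => absurd h' h⟩
  choose R hRsub hRcard hRmem using hex
  refine OBreakerBlock.step M B (fun h => ?_) (fun x y => R s(x, y)) (fun x y _ _ => hRsub _)
    (fun x y _ _ => hRcard _) fun x y hX hfree => ?_
  · obtain ⟨e, he, hse, hne⟩ := hW M hMX h
    exact Finset.disjoint_left.1 hdisj hse (hpair e he hne (hMX hse))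
  · set e := s(x, y) with he
    have hund : undirect (insert (x, y) M) = insert e (undirect M) := undirect_insert x y M
    rw [Finset.mem_union, not_or] at hfree
    refine ih _ ?_ _ _ ?_ ?_ ?_ rfl
    · rw [← hn, hund]
      refine Finset.card_lt_card ⟨fun z hz => ?_, fun h => ?_⟩
      · simp only [Finset.mem_sdiff, Finset.mem_union, Finset.mem_insert] at hz ⊢
        tauto
      · have := @h e (by simp [hX, hfree])
        simp at this
    · rw [hund]
      exact Finset.insert_subset hX hMX
    · rw [hund, Finset.disjoint_union_right]
      refine ⟨Finset.disjoint_insert_left.2 ⟨hfree.2, hdisj⟩, ?_⟩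
      rw [Finset.disjoint_left]
      exact fun z hz hzR =>
        (Finset.mem_sdiff.1 (hRsub _ hzR)).2 (Finset.mem_union_left _ hz)
    · rw [hund]
      intro z hz hne hzX
      rw [Finset.mem_union]
      rcases Finset.mem_insert.1 hz with hze | hz
      · rw [hze] at hne hzX ⊢
        clear hz hze z
        by_cases hzB : σ e ∈ B
        · exact Or.inl hzB
        · refine Or.inr (hRmem _ (Finset.mem_sdiff.2 ⟨hzX, ?_⟩))
          simp only [Finset.mem_union, Finset.mem_insert, not_or]
          refine ⟨⟨hne, fun h => ?_⟩, hzB⟩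
          have h2 := hpair _ h (by rw [hσ]; exact hne.symm) (by rw [hσ]; exact hX)
          rw [hσ] at h2
          exact hfree.2 h2
      · exact Or.inl (hpair z hz hne hzX)

section CliqueFamilies

/-- The edges of the complete graph on `Q`. -/
def cliqueEdges (Q : Finset V) : Finset (Sym2 V) :=
  Q.offDiag.image fun p => s(p.1, p.2)

lemma mem_cliqueEdges {Q : Finset V} {x y : V} :
    s(x, y) ∈ cliqueEdges Q ↔ x ∈ Q ∧ y ∈ Q ∧ x ≠ y := by
  simp only [cliqueEdges, Finset.mem_image, Finset.mem_offDiag, Prod.exists, Sym2.eq_iff]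
  constructor
  · rintro ⟨a, b, ⟨ha, hb, hab⟩, ⟨rfl, rfl⟩ | ⟨rfl, rfl⟩⟩
    · exact ⟨ha, hb, hab⟩
    · exact ⟨hb, ha, hab.symm⟩
  · rintro ⟨hx, hy, hxy⟩
    exact ⟨x, y, ⟨hx, hy, hxy⟩, Or.inl ⟨rfl, rfl⟩⟩

lemma card_cliqueEdges (Q : Finset V) : (cliqueEdges Q).card = Q.card.choose 2 :=
  Sym2.card_image_offDiag Q

lemma not_isDiag_of_mem_cliqueEdges {Q : Finset V} {e : Sym2 V} (he : e ∈ cliqueEdges Q) :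
    ¬ e.IsDiag := by
  induction e using Sym2.ind with
  | _ x y => exact (mem_cliqueEdges.1 he).2.2

lemma cliqueEdges_inter (Q R : Finset V) :
    cliqueEdges Q ∩ cliqueEdges R = cliqueEdges (Q ∩ R) := by
  ext e
  induction e using Sym2.ind with
  | _ x y => simp only [Finset.mem_inter, mem_cliqueEdges]; tauto

/-- The edges of a family of cliques. -/
def familyEdges (C : Finset (Finset V)) : Finset (Sym2 V) := C.biUnion cliqueEdges

/-- The vertices of a family of cliques. -/
def familyVerts (C : Finset (Finset V)) : Finset V := C.biUnion id

lemma familyEdges_mono {C D : Finset (Finset V)} (h : C ⊆ D) : familyEdges C ⊆ familyEdges D :=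
  Finset.biUnion_subset_biUnion_of_subset_left _ h

lemma cliqueEdges_subset_familyEdges {C : Finset (Finset V)} {Q : Finset V} (h : Q ∈ C) :
    cliqueEdges Q ⊆ familyEdges C :=
  Finset.subset_biUnion_of_mem _ h

/-- A family of cliques is edge-connected if it cannot be split into two nonempty parts without
a common edge. -/
def EdgeConnected (C : Finset (Finset V)) : Prop :=
  ∀ D ⊆ C, D.Nonempty → D ≠ C →
    ∃ Q ∈ D, ∃ R ∈ C \ D, ∃ e ∈ cliqueEdges Q, e ∈ cliqueEdges R

/-- Some involution moving only edges of `S` pairs up two edges of each clique of `C`. -/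
def PairedOn (S : Finset (Sym2 V)) (C : Finset (Finset V)) : Prop :=
  ∃ σ : Sym2 V → Sym2 V, (∀ e, σ (σ e) = e) ∧ (∀ e ∉ S, σ e = e) ∧
    ∀ Q ∈ C, ∃ e ∈ cliqueEdges Q, σ e ∈ cliqueEdges Q ∧ σ e ≠ e

lemma PairedOn.mono {S S' : Finset (Sym2 V)} {C : Finset (Finset V)} (h : PairedOn S C)
    (hS : S ⊆ S') : PairedOn S' C := by
  obtain ⟨σ, h1, h2, h3⟩ := h
  exact ⟨σ, h1, fun e he => h2 e fun h => he (hS h), h3⟩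

lemma PairedOn.union {S S' : Finset (Sym2 V)} {C D : Finset (Finset V)} (h : PairedOn S C)
    (h' : PairedOn S' D) (hdisj : Disjoint S S') : PairedOn (S ∪ S') (C ∪ D) := by
  obtain ⟨σ, h1, h2, h3⟩ := h
  obtain ⟨τ, k1, k2, k3⟩ := h'
  have hσS : ∀ e ∈ S, σ e ∈ S := fun e he => by
    by_contra hn
    have := h2 _ hn
    rw [h1] at this
    exact hn (this ▸ he)
  have hτS : ∀ e ∉ S, τ e ∉ S := fun e he hn => by
    have := k2 _ (Finset.disjoint_left.1 hdisj hn)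
    rw [k1] at this
    exact he (this ▸ hn)
  refine ⟨fun e => if e ∈ S then σ e else τ e, fun e => ?_, fun e he => ?_, fun Q hQ => ?_⟩
  · by_cases he : e ∈ S
    · simp [he, hσS e he, h1]
    · simp [he, hτS e he, k1]
  · rw [Finset.mem_union, not_or] at he
    simp [he.1, k2 e he.2]
  · rcases Finset.mem_union.1 hQ with hQ | hQ
    · obtain ⟨e, he, hse, hne⟩ := h3 Q hQ
      have heS : e ∈ S := by
        by_contra hn
        exact hne (h2 e hn)
      exact ⟨e, he, by simpa [heS] using hse, by simpa [heS] using hne⟩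
    · obtain ⟨e, he, hse, hne⟩ := k3 Q hQ
      have heS : e ∉ S := fun hS => hne (k2 e (Finset.disjoint_left.1 hdisj hS))
      exact ⟨e, he, by simpa [heS] using hse, by simpa [heS] using hne⟩

/-- On a set of at most `k` elements, `k ≥ 4`, one can form pairs such that each subset of at least
`k - 1` elements contains a pair. -/
lemma exists_pairing_of_card_le {α : Type*} [DecidableEq α] {k : ℕ} (hk : 4 ≤ k) {F : Finset α}
    (hF : F.card ≤ k) : ∃ σ : α → α, (∀ e, σ (σ e) = e) ∧ (∀ e ∉ F, σ e = e) ∧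
      ∀ S ⊆ F, k ≤ S.card + 1 → ∃ e ∈ S, σ e ∈ S ∧ σ e ≠ e := by
  by_cases hsmall : F.card + 1 < k
  · refine ⟨id, fun _ => rfl, fun _ _ => rfl, fun S hS hc => ?_⟩
    have := Finset.card_le_card hS
    omega
  obtain ⟨a, ha, b, hb, hab⟩ := Finset.one_lt_card.1 (show 1 < F.card by omega)
  by_cases h4 : F.card < 4
  · refine ⟨Equiv.swap a b, fun e => Equiv.swap_apply_self a b e, fun e he => ?_,
      fun S hS hc => ?_⟩
    · exact Equiv.swap_apply_of_ne_of_ne (fun h => he (h ▸ ha)) (fun h => he (h ▸ hb))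
    · have hSF : S = F := Finset.eq_of_subset_of_card_le hS (by omega)
      subst hSF
      exact ⟨a, ha, by simpa using hb, by simpa using hab.symm⟩
  · obtain ⟨c, hc, d, hd, hcd⟩ := Finset.one_lt_card.1
      (show 1 < ((F.erase a).erase b).card by
        rw [Finset.card_erase_of_mem (Finset.mem_erase.2 ⟨hab.symm, hb⟩),
          Finset.card_erase_of_mem ha]
        omega)
    simp only [Finset.mem_erase] at hc hd
    obtain ⟨hcb, hca, hcF⟩ := hc
    obtain ⟨hdb, hda, hdF⟩ := hd
    have hmiss : ∀ S ⊆ F, k ≤ S.card + 1 → ∀ x ∈ F, ∀ y ∈ F, x ≠ y → x ∉ S → y ∈ S := by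
      intro S hS hc x hx y hy hxy hxS
      by_contra hyS
      have hsub : S ⊆ (F.erase x).erase y := fun z hz => Finset.mem_erase.2
        ⟨fun h => hyS (h ▸ hz), Finset.mem_erase.2 ⟨fun h => hxS (h ▸ hz), hS hz⟩⟩
      have := Finset.card_le_card hsub
      rw [Finset.card_erase_of_mem (Finset.mem_erase.2 ⟨hxy.symm, hy⟩),
        Finset.card_erase_of_mem hx] at this
      omega
    have hva : (Equiv.swap a b * Equiv.swap c d) a = b := by
      rw [Equiv.Perm.mul_apply, Equiv.swap_apply_of_ne_of_ne hca.symm hda.symm,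
        Equiv.swap_apply_left]
    have hvb : (Equiv.swap a b * Equiv.swap c d) b = a := by
      rw [Equiv.Perm.mul_apply, Equiv.swap_apply_of_ne_of_ne hcb.symm hdb.symm,
        Equiv.swap_apply_right]
    have hvc : (Equiv.swap a b * Equiv.swap c d) c = d := by
      rw [Equiv.Perm.mul_apply, Equiv.swap_apply_left, Equiv.swap_apply_of_ne_of_ne hda hdb]
    have hvd : (Equiv.swap a b * Equiv.swap c d) d = c := by
      rw [Equiv.Perm.mul_apply, Equiv.swap_apply_right, Equiv.swap_apply_of_ne_of_ne hca hcb]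
    have hv : ∀ e, e ≠ a → e ≠ b → e ≠ c → e ≠ d →
        (Equiv.swap a b * Equiv.swap c d) e = e := fun e h1 h2 h3 h4 => by
      rw [Equiv.Perm.mul_apply, Equiv.swap_apply_of_ne_of_ne h3 h4,
        Equiv.swap_apply_of_ne_of_ne h1 h2]
    refine ⟨Equiv.swap a b * Equiv.swap c d, fun e => ?_, fun e he => ?_, fun S hS hSc => ?_⟩
    · by_cases h1 : e = a
      · rw [h1, hva, hvb]
      by_cases h2 : e = b
      · rw [h2, hvb, hva]
      by_cases h3 : e = c
      · rw [h3, hvc, hvd]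
      by_cases h4 : e = d
      · rw [h4, hvd, hvc]
      rw [hv e h1 h2 h3 h4, hv e h1 h2 h3 h4]
    · exact hv e (fun h => he (h ▸ ha)) (fun h => he (h ▸ hb)) (fun h => he (h ▸ hcF))
        (fun h => he (h ▸ hdF))
    · have hm := hmiss S hS hSc
      by_cases hboth : a ∈ S ∧ b ∈ S
      · exact ⟨a, hboth.1, by rw [hva]; exact hboth.2, by rw [hva]; exact hab.symm⟩
      · have hcdS : c ∈ S ∧ d ∈ S := by
          by_cases haS : a ∈ S
          · have hbS : b ∉ S := fun h => hboth ⟨haS, h⟩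
            exact ⟨hm b hb c hcF hcb.symm hbS, hm b hb d hdF hdb.symm hbS⟩
          · exact ⟨hm a ha c hcF hca.symm haS, hm a ha d hdF hda.symm haS⟩
        exact ⟨c, hcdS.1, by rw [hvc]; exact hcdS.2, by rw [hvc]; exact hcd.symm⟩

/-- A family with few edges has a vertex on at most `k` of its edges. -/
lemma exists_degree_le {k : ℕ} {C : Finset (Finset V)}
    (h : 2 * (familyEdges C).card < (k + 1) * (familyVerts C).card) :
    ∃ v ∈ familyVerts C, ((familyEdges C).filter fun e => v ∈ e).card ≤ k := by
  by_contra! hcon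
  have h1 : ∑ v ∈ familyVerts C, ((familyEdges C).filter fun e => v ∈ e).card
      ≤ 2 * (familyEdges C).card := by
    simp only [Finset.card_filter]
    rw [Finset.sum_comm, mul_comm, ← smul_eq_mul]
    refine Finset.sum_le_card_nsmul _ _ _ fun e he => ?_
    rw [← Finset.card_filter]
    obtain ⟨Q, -, he⟩ := Finset.mem_biUnion.1 he
    rw [← Sym2.card_toFinset_of_not_isDiag e (not_isDiag_of_mem_cliqueEdges he)]
    exact Finset.card_le_card fun v hv => Sym2.mem_toFinset.2 (Finset.mem_filter.1 hv).2
  have h2 : (familyVerts C).card * (k + 1)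
      ≤ ∑ v ∈ familyVerts C, ((familyEdges C).filter fun e => v ∈ e).card := by
    rw [← smul_eq_mul]
    exact Finset.card_nsmul_le_sum _ _ _ fun v hv => hcon v hv
  rw [mul_comm] at h2
  omega

/-- If all edge-connected subfamilies of a family of `k`-cliques are sparse, then Breaker can pair
up two edges of each clique. -/
theorem pairedOn_of_sparse {k : ℕ} (hk : 4 ≤ k) (C : Finset (Finset V))
    (hcard : ∀ Q ∈ C, Q.card = k)
    (hsparse : ∀ D ⊆ C, D.Nonempty → EdgeConnected D →
      2 * (familyEdges D).card < (k + 1) * (familyVerts D).card) :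
    PairedOn (familyEdges C) C := by
  induction C using Finset.strongInduction with
  | H C ih =>
  have ih' : ∀ D, D ⊂ C → PairedOn (familyEdges D) D := fun D hD =>
    ih D hD (fun Q hQ => hcard Q (hD.1 hQ)) fun D' hD' => hsparse D' (hD'.trans hD.1)
  rcases C.eq_empty_or_nonempty with rfl | hne
  · exact ⟨id, fun _ => rfl, fun _ _ => rfl, by simp⟩
  by_cases hconn : EdgeConnected C
  · obtain ⟨v, hv, hdeg⟩ := exists_degree_le (hsparse C Finset.Subset.rfl hne hconn)
    obtain ⟨Q₀, hQ₀, hvQ₀⟩ := Finset.mem_biUnion.1 hv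
    set F := (familyEdges C).filter fun e => v ∈ e with hF
    have hstar : PairedOn F (C.filter fun Q => v ∈ Q) := by
      obtain ⟨σ, h1, h2, h3⟩ := exists_pairing_of_card_le hk hdeg
      refine ⟨σ, h1, h2, fun Q hQ => ?_⟩
      obtain ⟨hQC, hvQ⟩ := Finset.mem_filter.1 hQ
      obtain ⟨e, he, hse, hne⟩ := h3 ((Q.erase v).image fun w => s(v, w)) (by
          intro e he
          obtain ⟨w, hw, rfl⟩ := Finset.mem_image.1 he
          obtain ⟨hwv, hwQ⟩ := Finset.mem_erase.1 hw
          exact Finset.mem_filter.2 ⟨cliqueEdges_subset_familyEdges hQC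
            (mem_cliqueEdges.2 ⟨hvQ, hwQ, hwv.symm⟩), Sym2.mem_mk_left v w⟩) (by
          rw [Finset.card_image_of_injective _ fun a b hab => Sym2.congr_right.1 hab,
            Finset.card_erase_of_mem hvQ, hcard Q hQC]
          omega)
      have hsub : ∀ e ∈ (Q.erase v).image (fun w => s(v, w)), e ∈ cliqueEdges Q := by
        intro e he
        obtain ⟨w, hw, rfl⟩ := Finset.mem_image.1 he
        obtain ⟨hwv, hwQ⟩ := Finset.mem_erase.1 hw
        exact mem_cliqueEdges.2 ⟨hvQ, hwQ, hwv.symm⟩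
      exact ⟨e, hsub e he, hsub _ hse, hne⟩
    have hrest := ih' (C.filter fun Q => v ∉ Q)
      (Finset.filter_ssubset.2 ⟨Q₀, hQ₀, by simpa using hvQ₀⟩)
    have hdisj : Disjoint F (familyEdges (C.filter fun Q => v ∉ Q)) := by
      rw [Finset.disjoint_left]
      intro e he he'
      obtain ⟨Q, hQ, heQ⟩ := Finset.mem_biUnion.1 he'
      have hve := (Finset.mem_filter.1 he).2
      induction e using Sym2.ind with
      | _ x y =>
        rw [mem_cliqueEdges] at heQ
        rcases Sym2.mem_iff.1 hve with rfl | rfl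
        · exact (Finset.mem_filter.1 hQ).2 heQ.1
        · exact (Finset.mem_filter.1 hQ).2 heQ.2.1
    have := hstar.union hrest hdisj
    rw [Finset.filter_union_filter_not_eq] at this
    exact this.mono (Finset.union_subset (Finset.filter_subset _ _)
      (familyEdges_mono (Finset.filter_subset _ _)))
  · unfold EdgeConnected at hconn
    push Not at hconn
    obtain ⟨D, hDC, hDne, hDC', hsep⟩ := hconn
    have h1 := ih' D (hDC.ssubset_of_ne hDC')
    have h2 := ih' (C \ D) (Finset.sdiff_ssubset hDC hDne)
    have hdisj : Disjoint (familyEdges D) (familyEdges (C \ D)) := by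
      rw [Finset.disjoint_left]
      intro e he he'
      obtain ⟨Q, hQ, heQ⟩ := Finset.mem_biUnion.1 he
      obtain ⟨R, hR, heR⟩ := Finset.mem_biUnion.1 he'
      exact hsep Q hQ R hR e heQ heR
    have := h1.union h2 hdisj
    rw [Finset.union_sdiff_of_subset hDC] at this
    exact this.mono (Finset.union_subset (familyEdges_mono hDC)
      (familyEdges_mono Finset.sdiff_subset))

end CliqueFamilies

/-- Breaker wins the tournament game if all edge-connected families of `k`-cliques of the board
are sparse. -/
theorem oBreakerBlock_of_sparse {k : ℕ} (hk : 4 ≤ k) {T : Fin k → Fin k → Prop}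
    (hT : IsTournament T) [Fintype V] (A : Finset (Sym2 V))
    (hsparse : ∀ D : Finset (Finset V), (∀ Q ∈ D, Q.card = k ∧ cliqueEdges Q ⊆ A) → D.Nonempty →
      EdgeConnected D → 2 * (familyEdges D).card < (k + 1) * (familyVerts D).card) :
    OBreakerBlock A (HasTCopy T) 1 ∅ ∅ := by
  obtain ⟨σ, h1, -, h3⟩ := pairedOn_of_sparse hk
    (Finset.univ.filter fun Q : Finset V => Q.card = k ∧ cliqueEdges Q ⊆ A)
    (fun Q hQ => (Finset.mem_filter.1 hQ).2.1)
    fun D hD => hsparse D fun Q hQ => (Finset.mem_filter.1 (hD hQ)).2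
  refine oBreakerBlock_of_pairing h1 (fun M hM hW => ?_) ∅ ∅ (by simp [undirect])
    (by simp) (by simp [undirect])
  obtain ⟨f, hf, hfM⟩ := hW
  have hsub : cliqueEdges (Finset.univ.image f) ⊆ undirect M := by
    intro e he
    induction e using Sym2.ind with
    | _ x y =>
      obtain ⟨hx, hy, hxy⟩ := mem_cliqueEdges.1 he
      obtain ⟨i, -, rfl⟩ := Finset.mem_image.1 hx
      obtain ⟨j, -, rfl⟩ := Finset.mem_image.1 hy
      have hij : i ≠ j := fun h => hxy (h ▸ rfl)
      by_cases hTij : T i j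
      · exact Finset.mem_image.2 ⟨(f i, f j), hfM i j hTij, rfl⟩
      · have hTji : T j i := by
          by_contra h
          exact hTij ((hT.2 i j hij).2 h)
        exact Finset.mem_image.2 ⟨(f j, f i), hfM j i hTji, Sym2.eq_swap⟩
  obtain ⟨e, he, hse, hne⟩ := h3 (Finset.univ.image f) (Finset.mem_filter.2
    ⟨Finset.mem_univ _, by rw [Finset.card_image_of_injective _ hf]; simp, hsub.trans hM⟩)
  exact ⟨e, hsub he, hsub hse, hne⟩

section Exploration

lemma familyVerts_insert (R : Finset V) (C : Finset (Finset V)) :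
    familyVerts (insert R C) = R ∪ familyVerts C := Finset.biUnion_insert

lemma card_familyVerts_insert (R : Finset V) (C : Finset (Finset V)) :
    (familyVerts (insert R C)).card + (R ∩ familyVerts C).card
      = (familyVerts C).card + R.card := by
  rw [familyVerts_insert, Finset.card_union_add_card_inter, add_comm]

lemma card_familyEdges_insert (R : Finset V) (C : Finset (Finset V)) :
    (familyEdges C).card + R.card.choose 2 ≤
      (familyEdges (insert R C)).card + (R ∩ familyVerts C).card.choose 2 := by
  have h1 := Finset.card_union_add_card_inter (cliqueEdges R) (familyEdges C)
  have h2 : cliqueEdges R ∩ familyEdges C ⊆ cliqueEdges (R ∩ familyVerts C) := by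
    intro e he
    obtain ⟨heR, heC⟩ := Finset.mem_inter.1 he
    obtain ⟨Q, hQ, heQ⟩ := Finset.mem_biUnion.1 heC
    have : e ∈ cliqueEdges (R ∩ Q) := by
      rw [← cliqueEdges_inter]
      exact Finset.mem_inter.2 ⟨heR, heQ⟩
    induction e using Sym2.ind with
    | _ x y =>
      obtain ⟨hx, hy, hxy⟩ := mem_cliqueEdges.1 this
      have hsub : R ∩ Q ⊆ R ∩ familyVerts C :=
        Finset.inter_subset_inter_left (Finset.subset_biUnion_of_mem id hQ)
      exact mem_cliqueEdges.2 ⟨hsub hx, hsub hy, hxy⟩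
  have h3 := Finset.card_le_card h2
  have h4 : familyEdges (insert R C) = cliqueEdges R ∪ familyEdges C := Finset.biUnion_insert
  rw [card_cliqueEdges] at h3
  rw [card_cliqueEdges] at h1
  rw [h4]
  omega

variable [Fintype V]

open Classical in
/-- The `k`-cliques sharing an edge with `Q` and having an edge not covered by the family `C`. -/
noncomputable def extensions (k : ℕ) (Q : Finset V) (C : Finset (Finset V)) :
    Finset (Finset V) :=
  Finset.univ.filter fun R => R.card = k ∧ 2 ≤ (R ∩ Q).card ∧ ¬ cliqueEdges R ⊆ familyEdges C

open Classical in
/-- The number of explorations of at most `m` steps starting from the family `C` with stack `q`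
that reach a dense family all of whose edges belong to `A`. -/
noncomputable def explorations (k : ℕ) (A : Finset (Sym2 V)) :
    ℕ → List (Finset V) → Finset (Finset V) → ℝ
  | 0, _, _ => 0
  | m + 1, q, C =>
    if (k + 1) * (familyVerts C).card ≤ 2 * (familyEdges C).card then
      if familyEdges C ⊆ A then 1 else 0
    else match q with
      | [] => 0
      | Q :: q => explorations k A m q C +
          ∑ R ∈ extensions k Q C, explorations k A m (R :: Q :: q) (insert R C)

/-- The excess of edges over vertices of a family of cliques, truncated at `2 * k`. -/
def excess (k : ℕ) (C : Finset (Finset V)) : ℕ :=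
  min (2 * (familyEdges C).card + 2 * k - (k + 1) * (familyVerts C).card) (2 * k)

/-- The potential function bounding the expected number of explorations. -/
noncomputable def potential (k : ℕ) (q : List (Finset V)) (C : Finset (Finset V)) : ℝ :=
  2 ^ q.length * ((1 / 2) ^ k / Fintype.card V) ^ (familyVerts C).card *
    (1 / 4) ^ ((familyVerts C).card * excess k C)

lemma potential_nonneg (k : ℕ) (q : List (Finset V)) (C : Finset (Finset V)) :
    0 ≤ potential k q C := by
  unfold potential
  positivity

lemma explorations_nonneg (k : ℕ) (A : Finset (Sym2 V)) (m : ℕ) (q : List (Finset V))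
    (C : Finset (Finset V)) : 0 ≤ explorations k A m q C := by
  induction m generalizing q C with
  | zero => simp [explorations]
  | succ m ih =>
    unfold explorations
    split_ifs
    · exact zero_le_one
    · exact le_rfl
    · cases q with
      | nil => exact le_rfl
      | cons Q q => exact add_nonneg (ih _ _) (Finset.sum_nonneg fun R _ => ih _ _)

lemma one_le_explorations {k : ℕ} {A : Finset (Sym2 V)} {D : Finset (Finset V)}
    (hD : ∀ Q ∈ D, Q.card = k ∧ cliqueEdges Q ⊆ A) (hconn : EdgeConnected D)
    (hdense : (k + 1) * (familyVerts D).card ≤ 2 * (familyEdges D).card)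
    (m : ℕ) (q : List (Finset V)) (C : Finset (Finset V)) (hCD : C ⊆ D) (hC : C.Nonempty)
    (hq : ∀ Q ∈ q, Q ∈ C)
    (hclosed : ∀ Q ∈ C, Q ∉ q → ∀ R ∈ D, 2 ≤ (R ∩ Q).card → cliqueEdges R ⊆ familyEdges C)
    (hm : 2 * ((familyEdges D).card - (familyEdges C).card) + q.length < m) :
    1 ≤ explorations k A m q C := by
  induction m generalizing q C with
  | zero => omega
  | succ m ih =>
    have hCA : familyEdges C ⊆ A :=
      Finset.biUnion_subset.2 fun Q hQ => (hD Q (hCD hQ)).2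
    unfold explorations
    split_ifs with hd
    · exact le_rfl
    · cases q with
      | nil =>
        exfalso
        have hsub : C ⊆ D.filter fun R => cliqueEdges R ⊆ familyEdges C := fun Q hQ =>
          Finset.mem_filter.2 ⟨hCD hQ, cliqueEdges_subset_familyEdges hQ⟩
        have hall : D.filter (fun R => cliqueEdges R ⊆ familyEdges C) = D := by
          by_contra hne
          obtain ⟨Q, hQ, R, hR, e, heQ, heR⟩ :=
            hconn _ (Finset.filter_subset _ _) (hC.mono hsub) hne
          obtain ⟨hRD, hR⟩ := Finset.mem_sdiff.1 hR
          obtain ⟨P, hP, heP⟩ := Finset.mem_biUnion.1 ((Finset.mem_filter.1 hQ).2 heQ)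
          refine hR (Finset.mem_filter.2 ⟨hRD, hclosed P hP (by simp) R hRD ?_⟩)
          have : e ∈ cliqueEdges (R ∩ P) := by
            rw [← cliqueEdges_inter]
            exact Finset.mem_inter.2 ⟨heR, heP⟩
          have hpos := Finset.card_pos.2 ⟨e, this⟩
          rw [card_cliqueEdges] at hpos
          by_contra hlt
          rw [Nat.choose_eq_zero_of_lt (by omega)] at hpos
          exact lt_irrefl _ hpos
        have hE : familyEdges D ⊆ familyEdges C := Finset.biUnion_subset.2 fun Q hQ => by
          rw [← hall] at hQ
          exact (Finset.mem_filter.1 hQ).2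
        have h1 := Finset.card_le_card hE
        have h2 : (familyVerts C).card ≤ (familyVerts D).card :=
          Finset.card_le_card (Finset.biUnion_subset_biUnion_of_subset_left _ hCD)
        have h3 := Nat.mul_le_mul_left (k + 1) h2
        omega
      | cons Q q =>
        dsimp only
        by_cases hex : ∃ R ∈ D, R ∈ extensions k Q C
        · obtain ⟨R, hRD, hR⟩ := hex
          have hRn : ¬ cliqueEdges R ⊆ familyEdges C := (Finset.mem_filter.1 hR).2.2.2
          have hins : insert R C ⊆ D := Finset.insert_subset hRD hCD
          have hlt : (familyEdges C).card < (familyEdges (insert R C)).card := by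
            refine Finset.card_lt_card ⟨familyEdges_mono (Finset.subset_insert _ _), fun h => ?_⟩
            exact hRn ((cliqueEdges_subset_familyEdges (Finset.mem_insert_self R C)).trans h)
          have hle := Finset.card_le_card (familyEdges_mono hins)
          have := ih (R :: Q :: q) (insert R C) hins (Finset.insert_nonempty _ _)
            (fun P hP => by
              rcases List.mem_cons.1 hP with rfl | hP
              · exact Finset.mem_insert_self _ _
              · exact Finset.mem_insert_of_mem (hq P hP))
            (fun P hP hPq S hS hSP => by
              have hPq' := not_or.1 (fun h => hPq (List.mem_cons.2 h))
              exact (hclosed P ((Finset.mem_insert.1 hP).resolve_left hPq'.1) hPq'.2 S hS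
                hSP).trans (familyEdges_mono (Finset.subset_insert _ _)))
            (by simp only [List.length_cons] at hm ⊢; omega)
          calc (1 : ℝ) ≤ _ := this
            _ ≤ ∑ R ∈ extensions k Q C, explorations k A m (R :: Q :: q) (insert R C) :=
              Finset.single_le_sum (f := fun R => explorations k A m (R :: Q :: q) (insert R C))
                (fun R _ => explorations_nonneg _ _ _ _ _) hR
            _ ≤ _ := le_add_of_nonneg_left (explorations_nonneg _ _ _ _ _)
        · push Not at hex
          have := ih q C hCD hC (fun P hP => hq P (List.mem_cons_of_mem _ hP))
            (fun P hP hPq S hS hSP => by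
              by_cases hPQ : P = Q
              · subst hPQ
                by_contra hn
                exact hex S hS (Finset.mem_filter.2 ⟨Finset.mem_univ _, (hD S hS).1, hSP, hn⟩)
              · exact hclosed P hP (fun h => (List.mem_cons.1 h).elim hPQ hPq) S hS hSP)
            (by simp only [List.length_cons] at hm; omega)
          exact this.trans (le_add_of_nonneg_right
            (Finset.sum_nonneg fun R _ => explorations_nonneg _ _ _ _ _))

lemma card_filter_inter_eq_le (k : ℕ) (U S : Finset V) :
    (Finset.univ.filter fun R : Finset V => R.card = k ∧ R ∩ U = S).card
      ≤ Fintype.card V ^ (k - S.card) := by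
  calc _ ≤ ((Finset.univ : Finset V).powersetCard (k - S.card)).card := by
        refine Finset.card_le_card_of_injOn (fun R => R \ U) (fun R hR => ?_)
          fun R hR R' hR' h => ?_
        · obtain ⟨hR1, hR2⟩ := (Finset.mem_filter.1 hR).2
          refine Finset.mem_powersetCard.2 ⟨Finset.subset_univ _, ?_⟩
          have := Finset.card_sdiff_add_card_inter R U
          rw [hR2, hR1] at this
          exact Nat.eq_sub_of_add_eq this
        · have h1 := (Finset.mem_filter.1 hR).2.2
          have h2 := (Finset.mem_filter.1 hR').2.2
          dsimp only at h
          rw [← Finset.sdiff_union_inter R U, ← Finset.sdiff_union_inter R' U, h, h1, h2]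
    _ ≤ _ := by
        rw [Finset.card_powersetCard, Finset.card_univ]
        exact Nat.choose_le_pow _ _

/-- Adding a clique does not decrease the excess, and increases it unless the clique has exactly
one edge within the old vertex set. -/
lemma excess_insert {k : ℕ} {C : Finset (Finset V)} {Q R : Finset V}
    (hX : (k + 1) * (familyVerts C).card ≤ 2 * (familyEdges C).card + 2 * k)
    (hd : ¬ (k + 1) * (familyVerts C).card ≤ 2 * (familyEdges C).card)
    (hR : R ∈ extensions k Q C) (hQ : Q ⊆ familyVerts C) :
    (k + 1) * (familyVerts (insert R C)).card ≤ 2 * (familyEdges (insert R C)).card + 2 * k ∧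
    excess k C ≤ excess k (insert R C) ∧
    ((R ∩ familyVerts C).card ≠ 2 → excess k C + 1 ≤ excess k (insert R C)) := by
  obtain ⟨hRk, hRQ, hRn⟩ := (Finset.mem_filter.1 hR).2
  have h1 := card_familyVerts_insert R C
  have h2 := card_familyEdges_insert R C
  have h3 : (familyEdges C).card < (familyEdges (insert R C)).card := by
    refine Finset.card_lt_card ⟨familyEdges_mono (Finset.subset_insert _ _), fun h => ?_⟩
    exact hRn ((cliqueEdges_subset_familyEdges (Finset.mem_insert_self R C)).trans h)
  have h4 : 2 ≤ (R ∩ familyVerts C).card :=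
    hRQ.trans (Finset.card_le_card (Finset.inter_subset_inter_left hQ))
  have h5 : (R ∩ familyVerts C).card ≤ R.card := Finset.card_le_card Finset.inter_subset_left
  unfold excess
  generalize (familyVerts (insert R C)).card = v' at *
  generalize (familyEdges (insert R C)).card = e' at *
  generalize (familyVerts C).card = v at *
  generalize (familyEdges C).card = e at *
  generalize (R ∩ familyVerts C).card = j at *
  rw [hRk] at h1 h2 h5
  obtain ⟨d, rfl⟩ := Nat.exists_eq_add_of_le h5
  obtain ⟨i, rfl⟩ := Nat.exists_eq_add_of_le h4
  obtain rfl : v' = v + d := by omega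
  have hc1 : (2 + i + d).choose 2 * 2 = (2 + i + d) * (1 + i + d) := by
    rw [Nat.choose_two_right, Nat.div_mul_cancel (Nat.even_mul_pred_self _).two_dvd]
    congr 1
    omega
  have hc2 : (2 + i).choose 2 * 2 = (2 + i) * (1 + i) := by
    rw [Nat.choose_two_right, Nat.div_mul_cancel (Nat.even_mul_pred_self _).two_dvd]
    congr 1
    omega
  have key : 2 * e + (2 + i + d + 1) * d + d * i ≤ 2 * e' := by nlinarith
  have hexp : (2 + i + d + 1) * (v + d) = (2 + i + d + 1) * v + (2 + i + d + 1) * d := by ring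
  rw [hexp]
  have hstep : 2 + i ≠ 2 →
      2 * e + (2 + i + d + 1) * d + 1 ≤ 2 * e' := by
    intro hi
    rcases Nat.eq_zero_or_pos d with rfl | hd
    · omega
    · have : 0 < d * i := Nat.mul_pos hd (by omega)
      omega
  refine ⟨by omega, by omega, fun hi => ?_⟩
  have := hstep hi
  omega

end Exploration

section ExpectedExplorations

variable [Fintype V]

lemma potential_cons (k : ℕ) (Q : Finset V) (q : List (Finset V)) (C : Finset (Finset V)) :
    potential k (Q :: q) C = 2 * potential k q C := by
  unfold potential
  rw [List.length_cons, pow_succ]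
  ring

lemma potential_insert_le {k : ℕ} {C : Finset (Finset V)} {Q R : Finset V}
    (q : List (Finset V))
    (hX : (k + 1) * (familyVerts C).card ≤ 2 * (familyEdges C).card + 2 * k)
    (hd : ¬ (k + 1) * (familyVerts C).card ≤ 2 * (familyEdges C).card)
    (hR : R ∈ extensions k Q C) (hQ : Q ⊆ familyVerts C) :
    potential k q (insert R C) ≤ potential k q C *
      (((1 / 2) ^ k / Fintype.card V) ^ (k - (R ∩ familyVerts C).card) *
        if (R ∩ familyVerts C).card = 2 then 1 else (1 / 4) ^ (familyVerts C).card) := by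
  obtain ⟨-, h1, h2⟩ := excess_insert hX hd hR hQ
  have hv : (familyVerts (insert R C)).card =
      (familyVerts C).card + (k - (R ∩ familyVerts C).card) := by
    have h3 := card_familyVerts_insert R C
    rw [(Finset.mem_filter.1 hR).2.1] at h3
    have h4 : (R ∩ familyVerts C).card ≤ R.card := Finset.card_le_card Finset.inter_subset_left
    rw [(Finset.mem_filter.1 hR).2.1] at h4
    omega
  have key : ((1 : ℝ) / 4) ^ ((familyVerts (insert R C)).card * excess k (insert R C)) ≤
      (1 / 4) ^ ((familyVerts C).card * excess k C) *
        if (R ∩ familyVerts C).card = 2 then 1 else (1 / 4) ^ (familyVerts C).card := by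
    split_ifs with h
    · rw [mul_one]
      refine pow_le_pow_of_le_one (by norm_num) (by norm_num) (Nat.mul_le_mul (by omega) h1)
    · rw [← pow_add, ← Nat.mul_succ]
      exact pow_le_pow_of_le_one (by norm_num) (by norm_num) (Nat.mul_le_mul (by omega) (h2 h))
  unfold potential
  rw [hv] at key ⊢
  rw [pow_add]
  refine (mul_le_mul_of_nonneg_left key (by positivity)).trans_eq ?_
  ring

lemma sum_extensions_le {k : ℕ} (hk : 4 ≤ k) [Nonempty V] {C : Finset (Finset V)} {Q : Finset V}
    (hQk : Q.card = k) (hQ : Q ⊆ familyVerts C) :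
    ∑ R ∈ extensions k Q C,
      (((1 : ℝ) / 2) ^ k / Fintype.card V) ^ (k - (R ∩ familyVerts C).card) *
        (if (R ∩ familyVerts C).card = 2 then 1 else (1 / 4) ^ (familyVerts C).card) ≤ 1 / 8 := by
  set U := familyVerts C with hU
  have hn : (0 : ℝ) < Fintype.card V := Nat.cast_pos.2 Fintype.card_pos
  have hkU : k ≤ U.card := hQk ▸ Finset.card_le_card hQ
  have hle : ∀ R ∈ extensions k Q C, 2 ≤ (R ∩ U).card := fun R hR =>
    (Finset.mem_filter.1 hR).2.2.1.trans (Finset.card_le_card (Finset.inter_subset_inter_left hQ))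
  rw [← Finset.sum_fiberwise_of_maps_to (s := extensions k Q C) (t := U.powerset)
    (g := fun R => R ∩ U) (fun R _ => Finset.mem_powerset.2 Finset.inter_subset_right)]
  have hfib : ∀ S ∈ U.powerset, ∑ R ∈ extensions k Q C with R ∩ U = S,
      (((1 : ℝ) / 2) ^ k / Fintype.card V) ^ (k - (R ∩ U).card) *
        (if (R ∩ U).card = 2 then 1 else (1 / 4) ^ U.card) ≤
      (if S ⊆ Q then (1 / 2) ^ (2 * k) else 0) + (1 / 4) ^ U.card := by
    intro S _
    set B : ℝ := if S ⊆ Q then (1 / 2) ^ (2 * k) else 0 with hB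
    have hB0 : 0 ≤ B := by rw [hB]; positivity
    by_cases hne : ((extensions k Q C).filter fun R => R ∩ U = S).Nonempty
    swap
    · rw [Finset.not_nonempty_iff_eq_empty.1 hne, Finset.sum_empty]
      positivity
    obtain ⟨R₀, hR₀⟩ := hne
    obtain ⟨hR₀, hR₀S⟩ := Finset.mem_filter.1 hR₀
    have hsum : ∑ R ∈ extensions k Q C with R ∩ U = S,
        (((1 : ℝ) / 2) ^ k / Fintype.card V) ^ (k - (R ∩ U).card) *
          (if (R ∩ U).card = 2 then 1 else (1 / 4) ^ U.card) ≤
        ((1 / 2) ^ k) ^ (k - S.card) * (if S.card = 2 then 1 else (1 / 4) ^ U.card) := by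
      have hcard : (((extensions k Q C).filter fun R => R ∩ U = S).card : ℝ) ≤
          (Fintype.card V : ℝ) ^ (k - S.card) := by
        rw [← Nat.cast_pow, Nat.cast_le]
        refine (Finset.card_le_card fun R hR => ?_).trans (card_filter_inter_eq_le k U S)
        obtain ⟨h1, h2⟩ := Finset.mem_filter.1 hR
        exact Finset.mem_filter.2 ⟨Finset.mem_univ _, (Finset.mem_filter.1 h1).2.1, h2⟩
      calc _ = ∑ R ∈ extensions k Q C with R ∩ U = S,
            (((1 : ℝ) / 2) ^ k / Fintype.card V) ^ (k - S.card) *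
              (if S.card = 2 then 1 else (1 / 4) ^ U.card) :=
            Finset.sum_congr rfl fun R hR => by rw [(Finset.mem_filter.1 hR).2]
        _ ≤ (Fintype.card V : ℝ) ^ (k - S.card) * _ := by
            rw [Finset.sum_const, nsmul_eq_mul]
            exact mul_le_mul_of_nonneg_right hcard (by positivity)
        _ = _ := by
            rw [← mul_assoc, ← mul_pow, mul_div_cancel₀ _ hn.ne']
    refine hsum.trans ?_
    split_ifs with h2
    · have hSQ : S ⊆ Q := by
        have h3 : R₀ ∩ Q ⊆ S := hR₀S ▸ Finset.inter_subset_inter_left hQ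
        have h4 := Finset.eq_of_subset_of_card_le h3
          (h2 ▸ (Finset.mem_filter.1 hR₀).2.2.1)
        exact h4 ▸ Finset.inter_subset_right
      rw [hB, if_pos hSQ, h2, mul_one, ← pow_mul]
      refine le_add_of_le_of_nonneg (pow_le_pow_of_le_one (by norm_num) (by norm_num) ?_)
        (by positivity)
      rw [mul_comm 2]
      exact Nat.mul_le_mul_left _ (by omega)
    · refine le_add_of_nonneg_of_le hB0 (mul_le_of_le_one_left (by positivity) ?_)
      exact pow_le_one₀ (by positivity) (pow_le_one₀ (by norm_num) (by norm_num))
  refine (Finset.sum_le_sum hfib).trans ?_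
  rw [Finset.sum_add_distrib, ← Finset.sum_filter, Finset.sum_const, Finset.sum_const,
    Finset.card_powerset, nsmul_eq_mul, nsmul_eq_mul]
  have h1 : ((U.powerset.filter fun S => S ⊆ Q).card : ℝ) ≤ 2 ^ k := by
    rw [← hQk, ← Nat.cast_two, ← Nat.cast_pow, ← Finset.card_powerset, Nat.cast_le]
    exact Finset.card_le_card fun S hS => Finset.mem_powerset.2 (Finset.mem_filter.1 hS).2
  have h2 : ((1 : ℝ) / 2) ^ k ≤ 1 / 16 :=
    (pow_le_pow_of_le_one (by norm_num) (by norm_num) hk).trans (by norm_num)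
  have h3 : ((1 : ℝ) / 2) ^ U.card ≤ 1 / 16 :=
    (pow_le_pow_of_le_one (by norm_num) (by norm_num) (hk.trans hkU)).trans (by norm_num)
  have h4 : (2 : ℝ) ^ k * (1 / 2) ^ (2 * k) = (1 / 2) ^ k := by
    rw [two_mul, pow_add, ← mul_assoc, ← mul_pow]
    norm_num
  have h5 : ((2 ^ U.card : ℕ) : ℝ) * (1 / 4) ^ U.card = (1 / 2) ^ U.card := by
    rw [Nat.cast_pow, ← mul_pow]
    norm_num
  rw [h5]
  have h6 := mul_le_mul_of_nonneg_right h1 (by positivity : (0 : ℝ) ≤ (1 / 2) ^ (2 * k))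
  linarith

/-- The expected number of explorations is at most a small multiple of the potential. -/
lemma edgeExp_explorations_le {k : ℕ} (hk : 4 ≤ k) [Nonempty V] {E : Finset (Sym2 V)}
    (hE : ∀ e : Sym2 V, ¬ e.IsDiag → e ∈ E) {p ε : ℝ} (hp0 : 0 ≤ p) (hp1 : p ≤ 1)
    (hε0 : 0 ≤ ε) (hε1 : ε ≤ 1)
    (hp : p ^ (k + 1) ≤ (ε * (1 / 2) ^ (5 * k) / Fintype.card V) ^ 2)
    (m : ℕ) (q : List (Finset V)) (C : Finset (Finset V)) (hC : 1 ≤ (familyVerts C).card)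
    (hq : ∀ Q ∈ q, Q.card = k ∧ Q ⊆ familyVerts C)
    (hX : (k + 1) * (familyVerts C).card ≤ 2 * (familyEdges C).card + 2 * k) :
    edgeExp E p (fun A => explorations k A m q C) ≤ ε * potential k q C := by
  have hn : (0 : ℝ) < Fintype.card V := Nat.cast_pos.2 Fintype.card_pos
  have hzero : edgeExp E p (fun _ => 0) = 0 := by simp [edgeExp]
  induction m generalizing q C with
  | zero =>
    simp only [explorations, hzero]
    exact mul_nonneg hε0 (potential_nonneg _ _ _)
  | succ m ih =>
    unfold explorations
    split_ifs with hd
    · have hCE : familyEdges C ⊆ E := Finset.biUnion_subset.2 fun Q _ e he =>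
        hE e (not_isDiag_of_mem_cliqueEdges he)
      rw [edgeExp_superset hCE]
      set v := (familyVerts C).card
      have h1 : p ^ (familyEdges C).card ≤ (ε * (1 / 2) ^ (5 * k) / Fintype.card V) ^ v := by
        refine (pow_le_pow_iff_left₀ (by positivity) (by positivity) two_ne_zero).1 ?_
        rw [← pow_mul, ← pow_mul, mul_comm v, pow_mul _ 2]
        calc p ^ ((familyEdges C).card * 2) ≤ p ^ ((k + 1) * v) :=
              pow_le_pow_of_le_one hp0 hp1 (by omega)
          _ = (p ^ (k + 1)) ^ v := pow_mul _ _ _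
          _ ≤ _ := by gcongr
      have h2 : (ε * (1 / 2) ^ (5 * k) / Fintype.card V) ^ v ≤
          ε * (1 * ((1 / 2) ^ k / Fintype.card V) ^ v * (1 / 4) ^ (v * (2 * k))) := by
        have : ((1 : ℝ) / 4) ^ (v * (2 * k)) = ((1 / 2) ^ (4 * k)) ^ v := by
          rw [← pow_mul, show ((1 : ℝ) / 4) = (1 / 2) ^ 2 by norm_num, ← pow_mul]
          congr 1
          ring
        rw [this, one_mul, ← mul_pow, show ε * (1 / 2) ^ (5 * k) / (Fintype.card V : ℝ) =
          ε * ((1 / 2) ^ k / Fintype.card V * (1 / 2) ^ (4 * k)) by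
            rw [show 5 * k = k + 4 * k by ring, pow_add]; ring, mul_pow]
        refine mul_le_mul_of_nonneg_right ?_ (by positivity)
        exact pow_le_of_le_one hε0 hε1 (by omega)
      refine h1.trans (h2.trans (mul_le_mul_of_nonneg_left ?_ hε0))
      unfold potential
      refine mul_le_mul (mul_le_mul_of_nonneg_right (one_le_pow₀ one_le_two) (by positivity))
        (pow_le_pow_of_le_one (by norm_num) (by norm_num)
          (Nat.mul_le_mul_left _ (min_le_right _ _))) (by positivity) (by positivity)
    · cases q with
      | nil =>
        dsimp only
        rw [hzero]
        exact mul_nonneg hε0 (potential_nonneg _ _ _)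
      | cons Q q =>
        obtain ⟨hQk, hQ⟩ := hq Q List.mem_cons_self
        dsimp only
        rw [edgeExp_add, edgeExp_sum]
        have h1 := ih q C hC (fun P hP => hq P (List.mem_cons_of_mem _ hP)) hX
        have h2 : ∑ R ∈ extensions k Q C,
            edgeExp E p (fun A => explorations k A m (R :: Q :: q) (insert R C)) ≤
            ∑ R ∈ extensions k Q C, ε * (2 * potential k (Q :: q) C) *
            ((((1 : ℝ) / 2) ^ k / Fintype.card V) ^ (k - (R ∩ familyVerts C).card) *
        (if (R ∩ familyVerts C).card = 2 then 1 else (1 / 4) ^ (familyVerts C).card)) := by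
          refine Finset.sum_le_sum fun R hR => ?_
          have hsub : familyVerts C ⊆ familyVerts (insert R C) := by
            rw [familyVerts_insert]
            exact Finset.subset_union_right
          have h3 := ih (R :: Q :: q) (insert R C) (hC.trans (Finset.card_le_card hsub))
            (fun P hP => by
              rcases List.mem_cons.1 hP with rfl | hP
              · refine ⟨(Finset.mem_filter.1 hR).2.1, ?_⟩
                rw [familyVerts_insert]
                exact Finset.subset_union_left
              · exact ⟨(hq P hP).1, (hq P hP).2.trans hsub⟩)
            (excess_insert hX hd hR hQ).1
          refine h3.trans ?_
          rw [mul_assoc, potential_cons, mul_assoc]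
          exact mul_le_mul_of_nonneg_left (mul_le_mul_of_nonneg_left
            (potential_insert_le _ hX hd hR hQ) zero_le_two) hε0
        rw [← Finset.mul_sum] at h2
        have h4 := mul_le_mul_of_nonneg_left (sum_extensions_le hk hQk hQ)
          (by have := potential_nonneg k (Q :: q) C; positivity :
            0 ≤ ε * (2 * potential k (Q :: q) C))
        have h5 := mul_nonneg hε0 (potential_nonneg k q C)
        rw [potential_cons] at h2 h4 ⊢
        linarith

end ExpectedExplorations

/-- Quantitative form of Breaker's side of the threshold. -/
theorem one_sub_le_edgeProb_oBreakerBlock {k : ℕ} (hk : 4 ≤ k) {T : Fin k → Fin k → Prop}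
    (hT : IsTournament T) [Fintype V] [Nonempty V] {E : Finset (Sym2 V)}
    (hE : ∀ e : Sym2 V, ¬ e.IsDiag → e ∈ E) {p ε : ℝ} (hp0 : 0 ≤ p) (hp1 : p ≤ 1)
    (hε0 : 0 ≤ ε) (hε1 : ε ≤ 1)
    (hp : p ^ (k + 1) ≤ (ε * (1 / 2) ^ (5 * k) / Fintype.card V) ^ 2) :
    1 - 2 * ε ≤ edgeProb E p (fun A => OBreakerBlock A (HasTCopy T) 1 ∅ ∅) := by
  have hn : (0 : ℝ) < Fintype.card V := Nat.cast_pos.2 Fintype.card_pos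
  have hsingle : ∀ Q : Finset V, familyVerts {Q} = Q := fun Q => Finset.singleton_biUnion
  have hsingle' : ∀ Q : Finset V, familyEdges {Q} = cliqueEdges Q := fun Q =>
    Finset.singleton_biUnion
  set N := 2 * Fintype.card (Sym2 V) + 2
  refine le_trans ?_ (one_sub_edgeExp_le_edgeProb hp0 hp1
    (f := fun A => ∑ Q ∈ (Finset.univ : Finset V).powersetCard k, explorations k A N [Q] {Q})
    (fun A _ => Finset.sum_nonneg fun Q _ => explorations_nonneg _ _ _ _ _) fun A _ hA => ?_)
  · rw [edgeExp_sum]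
    have h1 : ∀ Q ∈ (Finset.univ : Finset V).powersetCard k,
        edgeExp E p (fun A => explorations k A N [Q] {Q}) ≤
          ε * 2 * (1 / Fintype.card V) ^ k := by
      intro Q hQ
      have hQk := (Finset.mem_powersetCard.1 hQ).2
      refine (edgeExp_explorations_le hk hE hp0 hp1 hε0 hε1 hp N [Q] {Q} ?_ ?_ ?_).trans ?_
      · rw [hsingle]; omega
      · intro P hP
        rw [List.mem_singleton.1 hP, hsingle]
        exact ⟨hQk, Finset.Subset.rfl⟩
      · rw [hsingle, hsingle', card_cliqueEdges, hQk]
        have : k.choose 2 * 2 = k * (k - 1) := by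
          rw [Nat.choose_two_right, Nat.div_mul_cancel (Nat.even_mul_pred_self _).two_dvd]
        obtain ⟨j, rfl⟩ := Nat.exists_eq_add_of_le' (by omega : 1 ≤ k)
        rw [Nat.add_sub_cancel] at this
        nlinarith
      · rw [mul_assoc]
        refine mul_le_mul_of_nonneg_left ?_ hε0
        unfold potential
        rw [hsingle, hQk, List.length_singleton, pow_one]
        refine (mul_le_of_le_one_right (by positivity)
          (pow_le_one₀ (by norm_num) (by norm_num))).trans ?_
        gcongr
        exact pow_le_one₀ (by norm_num) (by norm_num)
    have h2 := Finset.sum_le_sum h1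
    rw [Finset.sum_const, Finset.card_powersetCard, Finset.card_univ, nsmul_eq_mul] at h2
    have h3 : ((Fintype.card V).choose k : ℝ) * (1 / Fintype.card V) ^ k ≤ 1 := by
      have : ((Fintype.card V).choose k : ℝ) ≤ (Fintype.card V : ℝ) ^ k := by
        exact_mod_cast Nat.choose_le_pow _ _
      refine (mul_le_mul_of_nonneg_right this (by positivity)).trans_eq ?_
      rw [← mul_pow, mul_one_div_cancel hn.ne', one_pow]
    have h4 := mul_le_mul_of_nonneg_left h3 (by positivity : 0 ≤ ε * 2)
    linarith
  · have : ¬ ∀ D : Finset (Finset V), (∀ Q ∈ D, Q.card = k ∧ cliqueEdges Q ⊆ A) → D.Nonempty →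
        EdgeConnected D → 2 * (familyEdges D).card < (k + 1) * (familyVerts D).card :=
      fun h => hA (oBreakerBlock_of_sparse hk hT A h)
    push Not at this
    obtain ⟨D, hD, ⟨Q, hQ⟩, hconn, hdense⟩ := this
    have h1 : 1 ≤ explorations k A N [Q] {Q} := by
      refine one_le_explorations hD hconn hdense N [Q] {Q} (Finset.singleton_subset_iff.2 hQ)
        (Finset.singleton_nonempty _) (by simp) (fun P hP hPQ => ?_) ?_
      · exact absurd (by simpa using hP) (by simpa using hPQ)
      · have := Finset.card_le_univ (familyEdges D)
        rw [List.length_singleton]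
        omega
    exact h1.trans (Finset.single_le_sum (f := fun Q => explorations k A N [Q] {Q})
      (fun R _ => explorations_nonneg _ _ _ _ _)
      (Finset.mem_powersetCard.2 ⟨Finset.subset_univ _, (hD Q hQ).1⟩))

section PartiteCopies

variable {k N : ℕ}

/-- The edges of the clique with one vertex, chosen by `g`, in each of the `k` classes of
size `N`. -/
def copyEdges (φ : Fin k × Fin N ↪ V) (g : Fin k → Fin N) : Finset (Sym2 V) :=
  cliqueEdges (Finset.univ.image fun i => φ (i, g i))

/-- The set of classes in which `g` and `h` choose the same vertex. -/
def agree (g h : Fin k → Fin N) : Finset (Fin k) :=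
  Finset.univ.filter fun i => g i = h i

lemma card_agree_lt {g h : Fin k → Fin N} (hgh : g ≠ h) : (agree g h).card < k := by
  obtain ⟨i, hi⟩ := Function.ne_iff.1 hgh
  have hmem : agree g h = Finset.univ → i ∈ agree g h := fun hu => hu ▸ Finset.mem_univ i
  refine (Finset.card_lt_card (Finset.ssubset_univ_iff.2 fun hu => hi ?_)).trans_eq
    (Finset.card_fin k)
  exact (Finset.mem_filter.1 (hmem hu)).2

lemma injective_section {W : Type*} (φ : Fin k × Fin N ↪ W) (g : Fin k → Fin N) :
    Function.Injective fun i => φ (i, g i) := fun _ _ h =>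
  (Prod.ext_iff.1 (φ.injective h)).1

lemma card_copyEdges (φ : Fin k × Fin N ↪ V) (g : Fin k → Fin N) :
    (copyEdges φ g).card = k.choose 2 := by
  rw [copyEdges, card_cliqueEdges, Finset.card_image_of_injective _ (injective_section φ g),
    Finset.card_fin]

lemma card_copyEdges_inter (φ : Fin k × Fin N ↪ V) (g h : Fin k → Fin N) :
    (copyEdges φ g ∩ copyEdges φ h).card = (agree g h).card.choose 2 := by
  have : (Finset.univ.image fun i => φ (i, g i)) ∩ (Finset.univ.image fun i => φ (i, h i)) =
      (agree g h).image fun i => φ (i, g i) := by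
    ext v
    simp only [Finset.mem_inter, Finset.mem_image, Finset.mem_univ, true_and, agree,
      Finset.mem_filter]
    constructor
    · rintro ⟨⟨i, rfl⟩, j, hj⟩
      obtain ⟨h1, h2⟩ := Prod.ext_iff.1 (φ.injective hj)
      dsimp only at h1 h2
      subst h1
      exact ⟨j, h2.symm, rfl⟩
    · rintro ⟨i, hi, rfl⟩
      exact ⟨⟨i, rfl⟩, i, by rw [hi]⟩
  rw [copyEdges, copyEdges, cliqueEdges_inter, card_cliqueEdges, this,
    Finset.card_image_of_injective _ (injective_section φ g)]

lemma card_copyEdges_union (φ : Fin k × Fin N ↪ V) (g h : Fin k → Fin N) :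
    (copyEdges φ g ∪ copyEdges φ h).card = 2 * k.choose 2 - (agree g h).card.choose 2 := by
  rw [Finset.card_union, card_copyEdges_inter, card_copyEdges, card_copyEdges, two_mul]

/-- The edges between the classes can be oriented so that each copy carries the tournament `T`. -/
lemma exists_orientation {T : Fin k → Fin k → Prop} (hT : IsTournament T)
    (φ : Fin k × Fin N ↪ V) :
    ∃ o : Sym2 V → V × V, (∀ e, s((o e).1, (o e).2) = e) ∧
      ∀ a b : Fin k × Fin N, T a.1 b.1 → o s(φ a, φ b) = (φ a, φ b) := by
  classical
  have hex : ∀ e : Sym2 V, ∃ q : V × V, s(q.1, q.2) = e ∧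
      ∀ a b : Fin k × Fin N, T a.1 b.1 → e = s(φ a, φ b) → q = (φ a, φ b) := by
    intro e
    by_cases h : ∃ a b : Fin k × Fin N, T a.1 b.1 ∧ e = s(φ a, φ b)
    · obtain ⟨a, b, hab, rfl⟩ := h
      refine ⟨(φ a, φ b), rfl, fun a' b' hab' he => ?_⟩
      rcases Sym2.eq_iff.1 he with ⟨h1, h2⟩ | ⟨h1, h2⟩
      · rw [h1, h2]
      · rw [← φ.injective h1, ← φ.injective h2] at hab'
        have hne : a.1 ≠ b.1 := fun h => hT.1 _ (h ▸ hab)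
        exact absurd hab' ((hT.2 _ _ hne).1 hab)
    · induction e using Sym2.ind with
      | _ x y => exact ⟨(x, y), rfl, fun a b hab he => absurd ⟨a, b, hab, he⟩ h⟩
  choose o ho1 ho2 using hex
  exact ⟨o, ho1, fun a b hab => ho2 _ a b hab rfl⟩

/-- The number of copies contained in `A`. -/
noncomputable def copyCount (φ : Fin k × Fin N ↪ V) (A : Finset (Sym2 V)) : ℝ :=
  ∑ g, if copyEdges φ g ⊆ A then 1 else 0

/-- The number of pairs of distinct copies contained in `A` and sharing at least three vertices. -/
noncomputable def conflictCount (φ : Fin k × Fin N ↪ V) (A : Finset (Sym2 V)) : ℝ :=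
  ∑ x : (Fin k → Fin N) × (Fin k → Fin N) with x.1 ≠ x.2 ∧ 3 ≤ (agree x.1 x.2).card,
    if copyEdges φ x.1 ∪ copyEdges φ x.2 ⊆ A then 1 else 0

/-- Maker wins if there are many copies and few conflicts. -/
lemma oMakerWin_of_copyCount {T : Fin k → Fin k → Prop} (hT : IsTournament T)
    (φ : Fin k × Fin N ↪ V) {X A : Finset (Sym2 V)} (hAX : A ⊆ X)
    (h : 2 ^ k.choose 2 * (A.card : ℝ) < copyCount φ A - conflictCount φ A) :
    OMakerWin X (HasTCopy T) 1 ∅ ∅ := by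
  obtain ⟨o, ho, hoT⟩ := exists_orientation hT φ
  set P := Finset.univ.filter fun x : (Fin k → Fin N) × (Fin k → Fin N) =>
    (x.1 ≠ x.2 ∧ 3 ≤ (agree x.1 x.2).card) ∧ copyEdges φ x.1 ∪ copyEdges φ x.2 ⊆ A with hP
  set S := Finset.univ.filter fun g : Fin k → Fin N => copyEdges φ g ⊆ A with hS
  have hY : copyCount φ A = S.card := by
    rw [copyCount, Finset.sum_boole]
  have hZ : conflictCount φ A = P.card := by
    rw [conflictCount, Finset.sum_boole, Finset.filter_filter]
  have hcard : (S.card : ℝ) - P.card ≤ (S \ P.image Prod.fst).card := by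
    have h1 := Finset.le_card_sdiff (P.image Prod.fst) S
    have h2 : (P.image Prod.fst).card ≤ P.card := Finset.card_image_le
    have h3 : S.card ≤ (S \ P.image Prod.fst).card + P.card := by omega
    have : (S.card : ℝ) ≤ (S \ P.image Prod.fst).card + P.card := by exact_mod_cast h3
    linarith
  have hsub : ∀ g ∈ S \ P.image Prod.fst, copyEdges φ g ⊆ A := fun g hg =>
    (Finset.mem_filter.1 (Finset.mem_sdiff.1 hg).1).2
  refine oMakerWin_of_weight hAX ho hsub (fun g hg h hh hgh => ?_) (fun M g _ hM => ?_) ∅ ∅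
    (by simp [undirect]) ?_
  · rw [card_copyEdges_inter]
    have : (agree g h).card ≤ 2 := by
      by_contra hlt
      refine (Finset.mem_sdiff.1 hg).2 (Finset.mem_image.2 ⟨(g, h), ?_, rfl⟩)
      exact Finset.mem_filter.2 ⟨Finset.mem_univ _, ⟨hgh, by dsimp only; omega⟩,
        Finset.union_subset (hsub g hg) (hsub h hh)⟩
    exact Nat.choose_le_choose 2 this
  · refine ⟨fun i => φ (i, g i), injective_section φ g, fun i j hij => ?_⟩
    have hne : i ≠ j := fun h => hT.1 i (by rw [← h] at hij; exact hij)
    have := hM s(φ (i, g i), φ (j, g j)) (mem_cliqueEdges.2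
      ⟨Finset.mem_image_of_mem _ (Finset.mem_univ i), Finset.mem_image_of_mem _ (Finset.mem_univ j),
        fun h => hne (injective_section φ g h)⟩)
    rwa [hoT (i, g i) (j, g j) hij] at this
  · have hw : ∀ g ∈ S \ P.image Prod.fst,
        setWeight (undirect (∅ : Finset (V × V))) ∅ (copyEdges φ g) =
          (1 / 2 : ℝ) ^ k.choose 2 := by
      intro g _
      simp [setWeight, undirect, card_copyEdges]
    rw [Finset.sum_congr rfl hw, Finset.sum_const, nsmul_eq_mul]
    have h2 : A \ (undirect (∅ : Finset (V × V)) ∪ ∅) = A := by simp [undirect]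
    rw [h2, one_div, inv_pow, ← div_eq_mul_inv, lt_div_iff₀ (by positivity)]
    linarith

lemma card_filter_agree_eq_le (J : Finset (Fin k)) :
    (Finset.univ.filter fun x : (Fin k → Fin N) × (Fin k → Fin N) => agree x.1 x.2 = J).card ≤
      N ^ k * N ^ (k - J.card) := by
  have h1 : (Finset.univ.filter fun x : (Fin k → Fin N) × (Fin k → Fin N) =>
      agree x.1 x.2 = J) ⊆ (Finset.univ : Finset (Fin k → Fin N)).biUnion fun g =>
        (Fintype.piFinset fun i => if i ∈ J then {g i} else Finset.univ).image (Prod.mk g) := by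
    rintro ⟨g, h⟩ hx
    refine Finset.mem_biUnion.2 ⟨g, Finset.mem_univ _, Finset.mem_image_of_mem _ ?_⟩
    refine Fintype.mem_piFinset.2 fun i => ?_
    split_ifs with hi
    · rw [← (Finset.mem_filter.1 hx).2] at hi
      exact Finset.mem_singleton.2 (Finset.mem_filter.1 hi).2.symm
    · exact Finset.mem_univ _
  refine (Finset.card_le_card h1).trans (Finset.card_biUnion_le.trans ?_)
  have h2 : ∀ g ∈ (Finset.univ : Finset (Fin k → Fin N)),
      ((Fintype.piFinset fun i => if i ∈ J then {g i} else Finset.univ).image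
        (Prod.mk g)).card ≤ N ^ (k - J.card) := by
    intro g _
    refine Finset.card_image_le.trans ?_
    rw [Fintype.card_piFinset]
    have : ∀ i, (if i ∈ J then ({g i} : Finset (Fin N)) else Finset.univ).card =
        if i ∈ J then 1 else N := by
      intro i
      split_ifs <;> simp
    simp_rw [this]
    rw [Finset.prod_ite, Finset.prod_const_one, one_mul, Finset.prod_const,
      ← Finset.compl_filter, Finset.card_compl]
    simp
  refine (Finset.sum_le_card_nsmul _ _ _ h2).trans ?_
  simp

/-- Sums over pairs of copies can be bounded according to the classes in which they agree. -/
lemma sum_pairs_le (f : ℕ → ℝ) (hf : ∀ j, 0 ≤ f j) (P : ℕ → Prop) [DecidablePred P] {B : ℝ}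
    (hB : ∀ j ≤ k, P j → N ^ k * N ^ (k - j) * f j ≤ B) (hB0 : 0 ≤ B) :
    ∑ x : (Fin k → Fin N) × (Fin k → Fin N) with P (agree x.1 x.2).card,
      f (agree x.1 x.2).card ≤ 2 ^ k * B := by
  rw [← Finset.sum_fiberwise_of_maps_to (t := (Finset.univ : Finset (Fin k)).powerset)
    (g := fun x => agree x.1 x.2) (fun x _ => Finset.mem_powerset.2 (Finset.subset_univ _))]
  have h1 : ∀ J ∈ (Finset.univ : Finset (Fin k)).powerset,
      ∑ x ∈ (Finset.univ.filter fun x : (Fin k → Fin N) × (Fin k → Fin N) =>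
        P (agree x.1 x.2).card) with agree x.1 x.2 = J, f (agree x.1 x.2).card ≤ B := by
    intro J _
    by_cases hJ : P J.card
    · refine le_trans ?_ (hB J.card ((Finset.card_le_univ J).trans_eq (Fintype.card_fin k)) hJ)
      have hcard : ((((Finset.univ.filter fun x : (Fin k → Fin N) × (Fin k → Fin N) =>
          P (agree x.1 x.2).card)).filter fun x => agree x.1 x.2 = J).card : ℝ) ≤
          N ^ k * N ^ (k - J.card) := by
        rw [← Nat.cast_pow, ← Nat.cast_pow, ← Nat.cast_mul, Nat.cast_le]
        exact (Finset.card_le_card (Finset.filter_subset_filter _ (Finset.subset_univ _))).trans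
          (card_filter_agree_eq_le J)
      rw [Finset.sum_congr rfl (g := fun _ => f J.card) fun x hx => by
        rw [(Finset.mem_filter.1 hx).2], Finset.sum_const, nsmul_eq_mul]
      exact mul_le_mul_of_nonneg_right hcard (hf _)
    · rw [Finset.sum_eq_zero]
      · exact hB0
      · intro x hx
        obtain ⟨h2, h3⟩ := Finset.mem_filter.1 hx
        exact absurd (h3 ▸ (Finset.mem_filter.1 h2).2) hJ
  refine (Finset.sum_le_sum h1).trans_eq ?_
  rw [Finset.sum_const, Finset.card_powerset, Finset.card_fin, nsmul_eq_mul]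
  norm_num

end PartiteCopies

section MakerProbability

variable {k N : ℕ}

lemma copyEdges_subset {E : Finset (Sym2 V)} (hE : ∀ e : Sym2 V, ¬ e.IsDiag → e ∈ E)
    (φ : Fin k × Fin N ↪ V) (g : Fin k → Fin N) : copyEdges φ g ⊆ E := fun e he =>
  hE e (not_isDiag_of_mem_cliqueEdges he)

lemma edgeExp_copyCount {E : Finset (Sym2 V)} (hE : ∀ e : Sym2 V, ¬ e.IsDiag → e ∈ E)
    (φ : Fin k × Fin N ↪ V) (p : ℝ) :
    edgeExp E p (copyCount φ) = N ^ k * p ^ k.choose 2 := by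
  unfold copyCount
  rw [edgeExp_sum]
  simp_rw [edgeExp_superset (copyEdges_subset hE φ _), card_copyEdges]
  simp

lemma edgeExp_copyCount_sq {E : Finset (Sym2 V)} (hE : ∀ e : Sym2 V, ¬ e.IsDiag → e ∈ E)
    (φ : Fin k × Fin N ↪ V) (p : ℝ) :
    edgeExp E p (fun A => copyCount φ A ^ 2) =
      ∑ x : (Fin k → Fin N) × (Fin k → Fin N),
        p ^ (2 * k.choose 2 - (agree x.1 x.2).card.choose 2) := by
  have h : (fun A => copyCount φ A ^ 2) = fun A =>
      ∑ x : (Fin k → Fin N) × (Fin k → Fin N),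
        if copyEdges φ x.1 ∪ copyEdges φ x.2 ⊆ A then (1 : ℝ) else 0 := by
    funext A
    rw [copyCount, sq, Finset.sum_mul_sum, ← Finset.univ_product_univ, Finset.sum_product]
    refine Finset.sum_congr rfl fun g _ => Finset.sum_congr rfl fun h _ => ?_
    by_cases hg : copyEdges φ g ⊆ A <;> by_cases hh : copyEdges φ h ⊆ A <;>
      simp [Finset.union_subset_iff, hg, hh]
  rw [h, edgeExp_sum]
  refine Finset.sum_congr rfl fun x _ => ?_
  rw [edgeExp_superset (Finset.union_subset (copyEdges_subset hE φ _) (copyEdges_subset hE φ _)),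
    card_copyEdges_union]

lemma edgeExp_conflictCount {E : Finset (Sym2 V)} (hE : ∀ e : Sym2 V, ¬ e.IsDiag → e ∈ E)
    (φ : Fin k × Fin N ↪ V) (p : ℝ) :
    edgeExp E p (conflictCount φ) =
      ∑ x : (Fin k → Fin N) × (Fin k → Fin N) with x.1 ≠ x.2 ∧ 3 ≤ (agree x.1 x.2).card,
        p ^ (2 * k.choose 2 - (agree x.1 x.2).card.choose 2) := by
  unfold conflictCount
  rw [edgeExp_sum]
  refine Finset.sum_congr rfl fun x _ => ?_
  rw [edgeExp_superset (Finset.union_subset (copyEdges_subset hE φ _) (copyEdges_subset hE φ _)),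
    card_copyEdges_union]

/-- The variance of the number of copies. -/
lemma edgeExp_copyCount_sub_sq_le {E : Finset (Sym2 V)}
    (hE : ∀ e : Sym2 V, ¬ e.IsDiag → e ∈ E) (φ : Fin k × Fin N ↪ V) {p η : ℝ} (hp0 : 0 ≤ p)
    (hη : 0 ≤ η) (h : ∀ j ≤ k, 2 ≤ j → 1 ≤ η * (N ^ j * p ^ j.choose 2)) :
    edgeExp E p (fun A => (copyCount φ A - N ^ k * p ^ k.choose 2) ^ 2) ≤
      2 ^ k * (η * (N ^ k * p ^ k.choose 2) ^ 2) := by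
  set μ : ℝ := N ^ k * p ^ k.choose 2 with hμ
  have h1 : (fun A => (copyCount φ A - μ) ^ 2) = fun A =>
      copyCount φ A ^ 2 + (-(2 * μ) * copyCount φ A + μ ^ 2 * 1) := by
    funext A
    ring
  have hconst : edgeExp E p (fun _ => μ ^ 2 * 1) = μ ^ 2 := by
    rw [edgeExp_const_mul, edgeExp_one, mul_one]
  have h2 : edgeExp E p (fun A => (copyCount φ A - μ) ^ 2) =
      ∑ x : (Fin k → Fin N) × (Fin k → Fin N),
        (p ^ (2 * k.choose 2 - (agree x.1 x.2).card.choose 2) - p ^ (2 * k.choose 2)) := by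
    rw [h1, edgeExp_add, edgeExp_add, edgeExp_copyCount_sq hE, edgeExp_const_mul, hconst,
      edgeExp_copyCount hE, ← hμ, Finset.sum_sub_distrib]
    have : ∑ _x : (Fin k → Fin N) × (Fin k → Fin N), p ^ (2 * k.choose 2) = μ ^ 2 := by
      rw [Finset.sum_const, Finset.card_univ, nsmul_eq_mul, hμ]
      simp only [Fintype.card_prod, Fintype.card_pi, Fintype.card_fin, Finset.prod_const,
        Finset.card_univ]
      push_cast
      ring
    rw [this]
    ring
  rw [h2]
  have h3 := sum_pairs_le (k := k) (N := N)
    (fun j => p ^ (2 * k.choose 2 - j.choose 2)) (fun j => pow_nonneg hp0 _) (fun j => 2 ≤ j)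
    (B := η * μ ^ 2) (fun j hj h2j => ?_) (by positivity)
  · refine le_trans ?_ h3
    rw [Finset.sum_filter]
    refine Finset.sum_le_sum fun x _ => ?_
    split_ifs with hx
    · exact sub_le_self _ (pow_nonneg hp0 _)
    · rw [Nat.choose_eq_zero_of_lt (not_le.1 hx), Nat.sub_zero, sub_self]
  · have hc : j.choose 2 ≤ k.choose 2 := Nat.choose_le_choose 2 hj
    have h4 : (N : ℝ) ^ k * N ^ (k - j) * p ^ (2 * k.choose 2 - j.choose 2) *
        (N ^ j * p ^ j.choose 2) = μ ^ 2 := by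
      have e1 : (N : ℝ) ^ k = N ^ (k - j) * N ^ j := by rw [← pow_add, Nat.sub_add_cancel hj]
      have e2 : p ^ (2 * k.choose 2) =
          p ^ (2 * k.choose 2 - j.choose 2) * p ^ j.choose 2 := by
        rw [← pow_add, Nat.sub_add_cancel (by omega)]
      calc _ = (N : ℝ) ^ k * (N ^ (k - j) * N ^ j) *
            (p ^ (2 * k.choose 2 - j.choose 2) * p ^ j.choose 2) := by ring
        _ = _ := by rw [← e1, ← e2, hμ]; ring
    have h5 := mul_le_mul_of_nonneg_left (h j hj h2j)
      (by positivity : 0 ≤ (N : ℝ) ^ k * N ^ (k - j) * p ^ (2 * k.choose 2 - j.choose 2))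
    rw [← h4]
    linarith

lemma edgeExp_conflictCount_le {E : Finset (Sym2 V)}
    (hE : ∀ e : Sym2 V, ¬ e.IsDiag → e ∈ E) (φ : Fin k × Fin N ↪ V) {p η : ℝ} (hp0 : 0 ≤ p)
    (hη : 0 ≤ η)
    (h : ∀ j < k, 3 ≤ j → N ^ (k - j) * p ^ (k.choose 2 - j.choose 2) ≤ η) :
    edgeExp E p (conflictCount φ) ≤ 2 ^ k * (η * (N ^ k * p ^ k.choose 2)) := by
  rw [edgeExp_conflictCount hE]
  have h3 := sum_pairs_le (k := k) (N := N)
    (fun j => p ^ (2 * k.choose 2 - j.choose 2)) (fun j => pow_nonneg hp0 _)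
    (fun j => 3 ≤ j ∧ j < k) (B := η * (N ^ k * p ^ k.choose 2)) (fun j _ hj => ?_)
    (by positivity)
  · refine le_trans (Finset.sum_le_sum_of_subset_of_nonneg (fun x hx => ?_)
      fun x _ _ => pow_nonneg hp0 _) h3
    obtain ⟨h1, h2⟩ := (Finset.mem_filter.1 hx).2
    exact Finset.mem_filter.2 ⟨Finset.mem_univ _, h2, card_agree_lt h1⟩
  · have hc : j.choose 2 ≤ k.choose 2 := Nat.choose_le_choose 2 hj.2.le
    have e2 : p ^ (2 * k.choose 2 - j.choose 2) =
        p ^ k.choose 2 * p ^ (k.choose 2 - j.choose 2) := by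
      rw [← pow_add]
      congr 1
      omega
    have h5 := mul_le_mul_of_nonneg_left (h j hj.2 hj.1)
      (by positivity : 0 ≤ (N : ℝ) ^ k * p ^ k.choose 2)
    rw [e2]
    linarith

/-- Quantitative form of Maker's side of the threshold. -/
theorem one_sub_le_edgeProb_oMakerWin {T : Fin k → Fin k → Prop} (hT : IsTournament T)
    {E : Finset (Sym2 V)} (hE : ∀ e : Sym2 V, ¬ e.IsDiag → e ∈ E) (φ : Fin k × Fin N ↪ V)
    {p p' η η' K : ℝ} (hp0 : 0 < p') (hpp : p' ≤ p) (hp1 : p ≤ 1) (hη : 0 ≤ η) (hη' : 0 ≤ η')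
    (hK : 0 < K) (hN : 0 < N) (hcardE : 0 < E.card)
    (hvar : ∀ j ≤ k, 2 ≤ j → 1 ≤ η * (N ^ j * p' ^ j.choose 2))
    (hconf : ∀ j < k, 3 ≤ j → N ^ (k - j) * p' ^ (k.choose 2 - j.choose 2) ≤ η')
    (hedge : 4 * 2 ^ k.choose 2 * K * (E.card * p') ≤ N ^ k * p' ^ k.choose 2) :
    1 - (1 / K + 4 * 2 ^ k * η + 4 * 2 ^ k * η') ≤
      edgeProb E p (fun A => OMakerWin A (HasTCopy T) 1 ∅ ∅) := by
  set Q : Finset (Sym2 V) → Prop := fun A => ∃ A' ⊆ A,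
    2 ^ k.choose 2 * (A'.card : ℝ) < copyCount φ A' - conflictCount φ A' with hQ
  have hp'1 := hpp.trans hp1
  have hcE : (0 : ℝ) < E.card := Nat.cast_pos.2 hcardE
  have hN' : (0 : ℝ) < N := Nat.cast_pos.2 hN
  set μ : ℝ := N ^ k * p' ^ k.choose 2 with hμ
  have hμ0 : 0 < μ := by positivity
  have hconf0 : ∀ A, 0 ≤ conflictCount φ A := fun A =>
    Finset.sum_nonneg fun x _ => by split_ifs <;> norm_num
  calc 1 - (1 / K + 4 * 2 ^ k * η + 4 * 2 ^ k * η')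
      ≤ 1 - edgeExp E p' (fun A => 1 / (K * (E.card * p')) * (A.card : ℝ) +
          (4 / μ ^ 2 * (copyCount φ A - μ) ^ 2 + 4 / μ * conflictCount φ A)) := by
        rw [edgeExp_add, edgeExp_add, edgeExp_const_mul, edgeExp_const_mul, edgeExp_const_mul,
          edgeExp_card]
        have h1 := edgeExp_copyCount_sub_sq_le hE φ hp0.le hη hvar
        have h2 := edgeExp_conflictCount_le hE φ hp0.le hη' hconf
        have h3 : 1 / (K * (E.card * p')) * (E.card * p') = 1 / K := by field_simp
        have h4 := mul_le_mul_of_nonneg_left h1 (by positivity : 0 ≤ 4 / μ ^ 2)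
        have h5 := mul_le_mul_of_nonneg_left h2 (by positivity : 0 ≤ 4 / μ)
        rw [← hμ] at h4 h5
        have h6 : 4 / μ ^ 2 * (2 ^ k * (η * μ ^ 2)) = 4 * 2 ^ k * η := by field_simp
        have h7 : 4 / μ * (2 ^ k * (η' * μ)) = 4 * 2 ^ k * η' := by field_simp
        linarith
    _ ≤ edgeProb E p' Q := by
        refine one_sub_edgeExp_le_edgeProb hp0.le hp'1 (fun A _ => ?_) fun A _ hA => ?_
        · have := hconf0 A
          positivity
        · by_contra! hlt
          have hc := hconf0 A
          have h1 : 0 ≤ 1 / (K * (E.card * p')) * (A.card : ℝ) := by positivity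
          have h2 : 0 ≤ 4 / μ ^ 2 * (copyCount φ A - μ) ^ 2 := by positivity
          have h3 : 0 ≤ 4 / μ * conflictCount φ A := by positivity
          have h4 : (A.card : ℝ) < K * (E.card * p') := by
            have : 1 / (K * (E.card * p')) * (A.card : ℝ) < 1 := by linarith
            rwa [one_div_mul_eq_div, div_lt_one (by positivity)] at this
          have h5 : conflictCount φ A < μ / 4 := by
            have : 4 / μ * conflictCount φ A < 1 := by linarith
            rw [div_mul_eq_mul_div, div_lt_one hμ0] at this
            linarith
          have h6 : μ / 2 < copyCount φ A := by
            have : 4 / μ ^ 2 * (copyCount φ A - μ) ^ 2 < 1 := by linarith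
            rw [div_mul_eq_mul_div, div_lt_one (by positivity)] at this
            nlinarith
          refine hA ⟨A, Finset.Subset.rfl, ?_⟩
          have h7 := mul_lt_mul_of_pos_left h4 (by positivity : (0 : ℝ) < 2 ^ k.choose 2)
          linarith
    _ ≤ edgeProb E p Q := edgeProb_mono_right hp0.le hpp hp1
        fun A B hAB ⟨A', hA', h⟩ => ⟨A', hA'.trans hAB, h⟩
    _ ≤ _ := edgeProb_mono (hp0.le.trans hpp) hp1
        fun A _ ⟨A', hA', h⟩ => oMakerWin_of_copyCount hT φ hA' h

end MakerProbability

section Estimates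

variable {k N : ℕ} {y C : ℝ}

lemma two_mul_choose_two (j : ℕ) : 2 * j.choose 2 + j = j * j := by
  have h : j.choose 2 * 2 = j * (j - 1) := by
    rw [Nat.choose_two_right, Nat.div_mul_cancel (Nat.even_mul_pred_self _).two_dvd]
  rcases j with _ | j
  · rfl
  · rw [Nat.add_sub_cancel] at h
    linarith

/-- Lower bound for the expected number of copies of a clique on `j` vertices. -/
lemma pow_le_mul_pow_choose (hy : 1 ≤ y) (hC : 1 ≤ C)
    (hN : y ^ (k + 1) ≤ 2 * k * N) {j : ℕ} (hj : j ≤ k) :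
    y ^ (j * (k + 2 - j)) * C ^ j.choose 2 ≤
      (2 * k) ^ j * (N ^ j * (C / y ^ 2) ^ j.choose 2) := by
  have hy0 : 0 < y := by linarith
  have h1 : (y ^ (k + 1)) ^ j ≤ (2 * k) ^ j * (N : ℝ) ^ j := by
    rw [← mul_pow]
    gcongr
  have h2 : (y ^ (k + 1)) ^ j = y ^ (j * (k + 2 - j)) * y ^ (2 * j.choose 2) := by
    rw [← pow_mul, ← pow_add]
    congr 1
    have := two_mul_choose_two j
    zify [(by omega : j ≤ k + 2)] at this ⊢
    linarith
  rw [div_pow, ← pow_mul, ← mul_div_assoc, ← mul_div_assoc, le_div_iff₀ (by positivity)]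
  calc _ = (y ^ (k + 1)) ^ j * C ^ j.choose 2 := by rw [h2]; ring
    _ ≤ ((2 * k) ^ j * (N : ℝ) ^ j) * C ^ j.choose 2 := by gcongr
    _ = _ := by ring

/-- Upper bound for the expected number of extensions of a clique on `j` vertices. -/
lemma mul_pow_choose_le (hy : 1 ≤ y) (hC : 1 ≤ C) (hN : (N : ℝ) ≤ y ^ (k + 1)) {j : ℕ}
    (hj : j < k) (h3 : 3 ≤ j) :
    N ^ (k - j) * (C / y ^ 2) ^ (k.choose 2 - j.choose 2) ≤ C ^ k.choose 2 / y := by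
  have hy0 : 0 < y := by linarith
  have h1 : (N : ℝ) ^ (k - j) ≤ (y ^ (k + 1)) ^ (k - j) := by gcongr
  have h2 : (y ^ (k + 1)) ^ (k - j) * y ≤ y ^ (2 * (k.choose 2 - j.choose 2)) := by
    rw [← pow_mul, ← pow_succ]
    refine pow_le_pow_right₀ hy ?_
    have e1 := two_mul_choose_two k
    have e2 := two_mul_choose_two j
    obtain ⟨d, rfl⟩ := Nat.exists_eq_add_of_lt hj
    obtain ⟨i, rfl⟩ := Nat.exists_eq_add_of_le h3
    have hle : (3 + i).choose 2 ≤ (3 + i + d + 1).choose 2 :=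
      Nat.choose_le_choose 2 (by omega)
    rw [show 3 + i + d + 1 - (3 + i) = d + 1 by omega, Nat.mul_sub]
    have : (3 + i + d + 1 + 1) * (d + 1) + 1 + 2 * (3 + i).choose 2 ≤
        2 * (3 + i + d + 1).choose 2 := by nlinarith
    omega
  rw [div_pow, ← pow_mul, ← mul_div_assoc, div_le_div_iff₀ (by positivity) hy0]
  calc _ ≤ (y ^ (k + 1)) ^ (k - j) * C ^ k.choose 2 * y := by
        gcongr
        exact Nat.sub_le _ _
    _ = C ^ k.choose 2 * ((y ^ (k + 1)) ^ (k - j) * y) := by ring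
    _ ≤ _ := by gcongr

end Estimates

lemma not_isDiag_imp_mem_completeEdges {n : ℕ} (e : Sym2 (Fin n)) (he : ¬ e.IsDiag) :
    e ∈ completeEdges n :=
  Finset.mem_filter.2 ⟨Finset.mem_univ _, he⟩

lemma card_completeEdges_le (n : ℕ) : (completeEdges n).card ≤ n ^ 2 := by
  calc _ ≤ Fintype.card (Sym2 (Fin n)) := Finset.card_le_univ _
    _ ≤ Fintype.card (Fin n × Fin n) :=
        Fintype.card_le_of_surjective (fun q : Fin n × Fin n => s(q.1, q.2))
          fun e => Sym2.ind (fun x y => ⟨(x, y), rfl⟩) e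
    _ = n ^ 2 := by simp [sq]

lemma one_sub_le_edgeProb_oMakerWin_completeEdges {k : ℕ} (hk : 4 ≤ k)
    {T : Fin k → Fin k → Prop} (hT : IsTournament T) {n : ℕ} (hn : 2 * k ≤ n) {p y C K : ℝ}
    (hy : y ^ (k + 1) = n) (hy1 : 1 ≤ y) (hK : 1 ≤ K)
    (hC : 4 * 2 ^ k.choose 2 * K * (2 * k) ^ k ≤ C)
    (hp : C / y ^ 2 ≤ p) (hp1 : p ≤ 1) :
    1 - (1 / K + 4 * 2 ^ k * ((2 * k) ^ k + C ^ k.choose 2) / y) ≤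
      edgeProb (completeEdges n) p (fun A => OMakerWin A (HasTCopy T) 1 ∅ ∅) := by
  have hkR : (1 : ℝ) ≤ 2 * k := by
    have : (4 : ℝ) ≤ k := by exact_mod_cast hk
    linarith
  have hC1 : 1 ≤ C := by
    refine le_trans ?_ hC
    have h1 : (1 : ℝ) ≤ (2 * k) ^ k := one_le_pow₀ hkR
    have h2 : (1 : ℝ) ≤ 2 ^ k.choose 2 := one_le_pow₀ one_le_two
    have h3 : (1 : ℝ) ≤ 4 * 2 ^ k.choose 2 := by linarith
    exact one_le_mul_of_one_le_of_one_le (one_le_mul_of_one_le_of_one_le h3 hK) h1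
  have hy0 : 0 < y := by linarith
  set N := n / k with hNdef
  have hNn : N * k ≤ n := Nat.div_mul_le_self n k
  have hN2 : n ≤ 2 * k * N := by
    have h1 : n < k * N + k := by
      have := Nat.lt_mul_div_succ n (by omega : 0 < k)
      rw [mul_add, mul_one] at this
      exact this
    have h2 : 2 ≤ N := (Nat.le_div_iff_mul_le (by omega)).2 hn
    nlinarith
  have hNlow : y ^ (k + 1) ≤ 2 * k * N := by
    rw [hy]
    exact_mod_cast hN2
  have hNup : (N : ℝ) ≤ y ^ (k + 1) := by
    rw [hy]
    exact_mod_cast Nat.div_le_self n k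
  have hN0 : 0 < N := Nat.div_pos (by omega) (by omega)
  let φ : Fin k × Fin N ↪ Fin n :=
    finProdFinEquiv.toEmbedding.trans (Fin.castLEEmb (by rw [mul_comm]; exact hNn))
  have hmem : s((⟨0, by omega⟩ : Fin n), ⟨1, by omega⟩) ∈ completeEdges n :=
    not_isDiag_imp_mem_completeEdges _ (by simp)
  refine le_trans ?_ (one_sub_le_edgeProb_oMakerWin hT not_isDiag_imp_mem_completeEdges φ
    (p' := C / y ^ 2) (η := (2 * k) ^ k / y) (η' := C ^ k.choose 2 / y) (K := K)
    (by positivity) hp hp1 (by positivity) (by positivity) (by linarith) hN0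
    (Finset.card_pos.2 ⟨_, hmem⟩) (fun j hj h2 => ?_)
    (fun j hj h3 => mul_pow_choose_le hy1 hC1 hNup hj h3) ?_)
  · rw [mul_add, add_div, mul_div_assoc, mul_div_assoc, add_assoc]
  · have h1 := pow_le_mul_pow_choose hy1 hC1 hNlow hj
    have h3 : y ≤ y ^ (j * (k + 2 - j)) * C ^ j.choose 2 := by
      refine (le_self_pow₀ hy1 (Nat.mul_ne_zero (by omega) (by omega))).trans
        (le_mul_of_one_le_right (by positivity) (one_le_pow₀ hC1))
    have h4 : ((2 : ℝ) * k) ^ j ≤ (2 * k) ^ k := pow_le_pow_right₀ hkR hj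
    rw [div_mul_eq_mul_div, le_div_iff₀ hy0, one_mul]
    exact (h3.trans h1).trans (mul_le_mul_of_nonneg_right h4 (by positivity))
  · have h1 := pow_le_mul_pow_choose hy1 hC1 hNlow le_rfl
    set μ : ℝ := N ^ k * (C / y ^ 2) ^ k.choose 2
    have hE : ((completeEdges n).card : ℝ) ≤ y ^ (k * 2) * y ^ 2 := by
      rw [← pow_add, show k * 2 + 2 = (k + 1) * 2 by ring, pow_mul, hy]
      exact_mod_cast card_completeEdges_le n
    have h2 : ((completeEdges n).card : ℝ) * (C / y ^ 2) ≤ y ^ (k * 2) * C := by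
      rw [← mul_div_assoc, div_le_iff₀ (by positivity)]
      calc _ ≤ y ^ (k * 2) * y ^ 2 * C := by gcongr
        _ = _ := by ring
    have h3 : C ^ 2 ≤ C ^ k.choose 2 := by
      refine pow_le_pow_right₀ hC1 ?_
      have := Nat.choose_le_choose 2 hk
      have h4 : Nat.choose 4 2 = 6 := rfl
      omega
    rw [show k + 2 - k = 2 by omega] at h1
    have hpos : (0 : ℝ) < (2 * k) ^ k := by positivity
    refine le_of_mul_le_mul_left ?_ hpos
    calc _ ≤ (2 * k) ^ k * (4 * 2 ^ k.choose 2 * K * (y ^ (k * 2) * C)) := by gcongr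
      _ = y ^ (k * 2) * ((4 * 2 ^ k.choose 2 * K * (2 * k) ^ k) * C) := by ring
      _ ≤ y ^ (k * 2) * (C * C) := by gcongr
      _ ≤ y ^ (k * 2) * C ^ k.choose 2 := by rw [← sq]; gcongr
      _ ≤ _ := h1

/-- For every tournament `T` on `k ≥ 4` vertices, `n^{-2/(k+1)}` is the
threshold probability for the unbiased `T`-tournament game on `G_{n,p}`. -/
theorem tournament_threshold_probability (k : ℕ) (hk : 4 ≤ k)
    (T : Fin k → Fin k → Prop) (hT : IsTournament T)
    (p : ℕ → ℝ) (hp0 : ∀ n, 0 ≤ p n) (hp1 : ∀ n, p n ≤ 1) :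
    (Filter.Tendsto (fun n : ℕ => p n * (n : ℝ) ^ (2 / (k + 1 : ℝ)))
        Filter.atTop Filter.atTop →
      Filter.Tendsto (fun n : ℕ => edgeProb (completeEdges n) (p n)
          (fun A => OMakerWin A (HasTCopy T) 1 ∅ ∅)) Filter.atTop (nhds 1)) ∧
    (Filter.Tendsto (fun n : ℕ => p n * (n : ℝ) ^ (2 / (k + 1 : ℝ)))
        Filter.atTop (nhds 0) →
      Filter.Tendsto (fun n : ℕ => edgeProb (completeEdges n) (p n)
          (fun A => OBreakerBlock A (HasTCopy T) 1 ∅ ∅)) Filter.atTop (nhds 1)) := by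
  constructor
  · intro hlim
    rw [Metric.tendsto_atTop']
    intro ε hε
    set K : ℝ := max 1 (4 / ε) with hK
    set C : ℝ := 4 * 2 ^ k.choose 2 * K * (2 * k) ^ k with hC
    have hroot : Filter.Tendsto (fun n : ℕ => (n : ℝ) ^ (1 / (k + 1 : ℝ)))
        Filter.atTop Filter.atTop :=
      (tendsto_rpow_atTop (by positivity)).comp tendsto_natCast_atTop_atTop
    have herr := (hroot.const_div_atTop
      (4 * 2 ^ k * ((2 * k) ^ k + C ^ k.choose 2))).eventually (gt_mem_nhds (half_pos hε))
    obtain ⟨n₀, hn₀⟩ := Filter.eventually_atTop.1 (herr.and ((hlim.eventually_ge_atTop C).and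
      ((hroot.eventually_ge_atTop 1).and (Filter.eventually_ge_atTop (2 * k)))))
    refine ⟨n₀, fun n hn => ?_⟩
    obtain ⟨h1, h2, h3, h4⟩ := hn₀ n hn.le
    have hy : ((n : ℝ) ^ (1 / (k + 1 : ℝ))) ^ (k + 1) = n := by
      rw [← Real.rpow_natCast, ← Real.rpow_mul (Nat.cast_nonneg n)]
      push_cast
      rw [one_div_mul_cancel (by positivity), Real.rpow_one]
    have hy2 : (n : ℝ) ^ (2 / (k + 1 : ℝ)) = ((n : ℝ) ^ (1 / (k + 1 : ℝ))) ^ 2 := by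
      rw [← Real.rpow_natCast, ← Real.rpow_mul (Nat.cast_nonneg n)]
      congr 1
      push_cast
      ring
    rw [hy2] at h2
    have hlow := one_sub_le_edgeProb_oMakerWin_completeEdges hk hT h4 hy h3
      (le_max_left 1 (4 / ε)) hC.ge
      ((div_le_iff₀ (by positivity)).2 h2) (hp1 n)
    have hup := edgeProb_le_one (E := completeEdges n) (hp0 n) (hp1 n)
      (fun A => OMakerWin A (HasTCopy T) 1 ∅ ∅)
    have hKε : 1 / K ≤ ε / 4 := by
      rw [div_le_div_iff₀ (by positivity) (by norm_num)]
      have h5 : 4 / ε ≤ K := le_max_right _ _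
      rw [div_le_iff₀ hε] at h5
      linarith
    rw [Real.dist_eq, abs_sub_lt_iff]
    constructor <;> linarith
  · intro hlim
    rw [Metric.tendsto_atTop']
    intro ε hε
    set ω : ℝ := min 1 (ε / 4) with hω
    have hω0 : 0 < ω := lt_min one_pos (by positivity)
    have hpow : Filter.Tendsto
        (fun n : ℕ => (p n * (n : ℝ) ^ (2 / (k + 1 : ℝ))) ^ (k + 1)) Filter.atTop (nhds 0) := by
      simpa using hlim.pow (k + 1)
    obtain ⟨n₀, hn₀⟩ := Filter.eventually_atTop.1 ((hpow.eventually (gt_mem_nhds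
      (by positivity : 0 < (ω * (1 / 2) ^ (5 * k)) ^ 2))).and (Filter.eventually_ge_atTop 1))
    refine ⟨n₀, fun n hn => ?_⟩
    obtain ⟨h1, h2⟩ := hn₀ n hn.le
    have : Nonempty (Fin n) := ⟨⟨0, h2⟩⟩
    have hn0 : (0 : ℝ) < n := Nat.cast_pos.2 h2
    have hy : ((n : ℝ) ^ (2 / (k + 1 : ℝ))) ^ (k + 1) = (n : ℝ) ^ 2 := by
      rw [← Real.rpow_natCast, ← Real.rpow_mul (Nat.cast_nonneg n)]
      push_cast
      rw [div_mul_cancel₀ _ (by positivity)]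
      exact Real.rpow_natCast _ 2
    rw [mul_pow, hy] at h1
    have hlow := one_sub_le_edgeProb_oBreakerBlock hk hT
      (not_isDiag_imp_mem_completeEdges (n := n)) (hp0 n) (hp1 n) hω0.le (min_le_left _ _) (by
        rw [Fintype.card_fin, div_pow, le_div_iff₀ (by positivity)]
        exact h1.le)
    have hup := edgeProb_le_one (E := completeEdges n) (hp0 n) (hp1 n)
      (fun A => OBreakerBlock A (HasTCopy T) 1 ∅ ∅)
    have hωε : ω ≤ ε / 4 := min_le_right _ _
    rw [Real.dist_eq, abs_sub_lt_iff]
    constructor <;> linarith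

end TournamentGame
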